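/- arXiv:1402.6405 — 2 statements merged into one kernel-verified Lean document; each statement's English description precedes it below -/
import Mathlib

section
/- Let F be an infinite field with char F ≠ 2 and let n ≥ 1. Let a = (α_1), b = (β_1), c = (γ_1, …, γ_r) be sequences of positive integers with sums at most n, and suppose the set of G-orbits on M_a × M_b × M_c under the diagonal action of G = O_{2n+1}(F) is finite. Then: (i) if r = 1 and α_1 ≤ β_1 ≤ γ_1, then α_1 = 1 or γ_1 = n; (ii) if r ≥ 2 and α_1 ≤ β_1, then α_1 = 1 or β_1 = n. -/
open Module

/-- The symmetric bilinear form on `F^N` given by `(e_i, e_j) = δ_{i, N+1-j}`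
(in 1-indexed notation), i.e. `(u, v) = ∑ i, u i * v (rev i)`. -/
def bform (F : Type*) [Field F] (N : ℕ) (u v : Fin N → F) : F :=
  ∑ i, u i * v i.rev

/-- `g` belongs to the split orthogonal group `O_N(F)`. -/
def IsOrthMap (F : Type*) [Field F] (N : ℕ)
    (g : (Fin N → F) ≃ₗ[F] (Fin N → F)) : Prop :=
  ∀ u v, bform F N (g u) (g v) = bform F N u v

/-- A subspace `V` is isotropic if `(V, V) = {0}`. -/
def IsIsotropic (F : Type*) [Field F] (N : ℕ) (V : Submodule F (Fin N → F)) : Prop :=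
  ∀ u ∈ V, ∀ v ∈ V, bform F N u v = 0

/-- A flag of type `a = (a 0, …, a (p-1))` in `F^{2n+1}` : an increasing chain of
subspaces `V 0 ⊆ ⋯ ⊆ V (p-1)` with `dim (V i) = a 0 + ⋯ + a i` which is isotropic
(equivalently, by monotonicity, whose top member is isotropic). -/
def IsFlag (F : Type*) [Field F] (n p : ℕ) (a : Fin p → ℕ)
    (V : Fin p → Submodule F (Fin (2*n+1) → F)) : Prop :=
  Monotone V ∧ (∀ i : Fin p, finrank F (V i) = ∑ j ∈ Finset.Iic i, a j) ∧
    ∀ i : Fin p, IsIsotropic F (2*n+1) (V i)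

/-- The flag variety `M_a`. -/
def FlagVar (F : Type*) [Field F] (n p : ℕ) (a : Fin p → ℕ) :=
  { V : Fin p → Submodule F (Fin (2*n+1) → F) // IsFlag F n p a V }

/-- The orbit relation of the diagonal action of `O_{2n+1}(F)` on the triple flag
variety `M_a × M_b × M_c`. -/
def TripleRel (F : Type*) [Field F] (n p q r : ℕ)
    (a : Fin p → ℕ) (b : Fin q → ℕ) (c : Fin r → ℕ)
    (x y : FlagVar F n p a × FlagVar F n q b × FlagVar F n r c) : Prop :=
  ∃ g : (Fin (2*n+1) → F) ≃ₗ[F] (Fin (2*n+1) → F), IsOrthMap F (2*n+1) g ∧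
    (∀ i, Submodule.map g.toLinearMap (x.1.1 i) = y.1.1 i) ∧
    (∀ i, Submodule.map g.toLinearMap (x.2.1.1 i) = y.2.1.1 i) ∧
    (∀ i, Submodule.map g.toLinearMap (x.2.2.1 i) = y.2.2.1 i)

section Bform

variable {F : Type*} [Field F] {N : ℕ}

lemma bform_comm (u v : Fin N → F) : bform F N u v = bform F N v u := by
  unfold bform
  rw [← Equiv.sum_comp Fin.revPerm]
  simp [mul_comm]

lemma bform_zero_left (v : Fin N → F) : bform F N 0 v = 0 := by simp [bform]

lemma bform_add_left (u u' v : Fin N → F) :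
    bform F N (u + u') v = bform F N u v + bform F N u' v := by
  simp [bform, add_mul, Finset.sum_add_distrib]

lemma bform_smul_left (a : F) (u v : Fin N → F) :
    bform F N (a • u) v = a * bform F N u v := by
  simp [bform, Finset.mul_sum, mul_assoc]

lemma bform_span_left {s : Set (Fin N → F)} {v : Fin N → F} (h : ∀ u ∈ s, bform F N u v = 0)
    {u : Fin N → F} (hu : u ∈ Submodule.span F s) : bform F N u v = 0 := by
  induction hu using Submodule.span_induction with
  | mem x hx => exact h x hx
  | zero => exact bform_zero_left v
  | add x y _ _ hx hy => rw [bform_add_left, hx, hy, add_zero]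
  | smul a x _ hx => rw [bform_smul_left, hx, mul_zero]

lemma isIsotropic_span {s : Set (Fin N → F)} (h : ∀ u ∈ s, ∀ v ∈ s, bform F N u v = 0) :
    IsIsotropic F N (Submodule.span F s) := by
  intro u hu v hv
  refine bform_span_left (fun x hx => ?_) hu
  rw [bform_comm]
  exact bform_span_left (fun y hy => h y hy x hx) hv

lemma bform_seven (u v : Fin 7 → F) : bform F 7 u v =
    u 0 * v 6 + u 1 * v 5 + u 2 * v 4 + u 3 * v 3 + u 4 * v 2 + u 5 * v 1 + u 6 * v 0 := by
  simp only [bform, Fin.sum_univ_seven]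
  rfl

end Bform

section InitialSpan

variable {F : Type*} [Field F] {n : ℕ}

/-- The span of the first `σ` members of a finite family. -/
def initialSpan {M : Type*} [AddCommGroup M] [Module F M] (b : Fin n → M) (σ : ℕ) :
    Submodule F M :=
  Submodule.span F (b '' {k | k.val < σ})

lemma finrank_initialSpan {M : Type*} [AddCommGroup M] [Module F M] {b : Fin n → M}
    (hb : LinearIndependent F b) {σ : ℕ} (hσ : σ ≤ n) :
    finrank F (initialSpan (F := F) b σ) = σ := by
  have h := finrank_span_eq_card (hb.comp (Fin.castLE hσ) (Fin.castLE_injective hσ))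
  rw [Fintype.card_fin, Set.range_comp] at h
  have hset : {k : Fin n | k.val < σ} = Set.range (Fin.castLE hσ) := by
    ext k
    simp only [Set.mem_ofPred_eq, Set.mem_range]
    exact ⟨fun hk => ⟨⟨k, hk⟩, rfl⟩, by rintro ⟨j, rfl⟩; exact j.2⟩
  rw [initialSpan, hset, h]

/-- The flag spanned by initial segments of an independent family of pairwise orthogonal
isotropic vectors. -/
def flagOfFamily {r : ℕ} (c : Fin r → ℕ) (hc : ∑ i, c i ≤ n)
    (b : Fin n → Fin (2 * n + 1) → F) (hb : LinearIndependent F b)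
    (hiso : ∀ k l, bform F (2 * n + 1) (b k) (b l) = 0) : FlagVar F n r c :=
  ⟨fun i => initialSpan b (∑ j ∈ Finset.Iic i, c j), by
    refine ⟨fun i j hij => ?_, fun i => ?_, fun i => ?_⟩
    · refine Submodule.span_mono (Set.image_mono fun k (hk : k.val < _) => hk.trans_le ?_)
      exact Finset.sum_le_sum_of_subset (Finset.Iic_subset_Iic.2 hij)
    · exact finrank_initialSpan hb
        ((Finset.sum_le_sum_of_subset (Finset.subset_univ _)).trans hc)
    · refine isIsotropic_span ?_
      rintro _ ⟨k, -, rfl⟩ _ ⟨l, -, rfl⟩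
      exact hiso k l⟩

end InitialSpan

section Family

variable {F : Type*} [Field F] {n : ℕ}

/-- The positions of `e_1, e_2, e_3, e_{n+1}, e_{2n-1}, e_{2n}, e_{2n+1}`. -/
def outerIdx (h : 3 ≤ n) : Fin 7 → Fin (2 * n + 1) :=
  ![⟨0, by omega⟩, ⟨1, by omega⟩, ⟨2, by omega⟩, ⟨n, by omega⟩, ⟨2 * n - 2, by omega⟩,
    ⟨2 * n - 1, by omega⟩, ⟨2 * n, by omega⟩]

lemma outerIdx_injective (h : 3 ≤ n) : Function.Injective (outerIdx h) := by
  intro i j hij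
  fin_cases i <;> fin_cases j <;> simp [outerIdx] at hij ⊢ <;> omega

lemma outerIdx_rev (h : 3 ≤ n) (i : Fin 7) : (outerIdx h i).rev = outerIdx h i.rev := by
  fin_cases i <;> ext <;> simp [outerIdx, Fin.rev] <;> omega

lemma notMem_range_outerIdx (h : 3 ≤ n) {k : Fin (2 * n + 1)} :
    k ∉ Set.range (outerIdx h) ↔
      (3 ≤ k.val ∧ k.val < n) ∨ (3 ≤ k.rev.val ∧ k.rev.val < n) := by
  rcases k with ⟨k, hk⟩
  simp only [outerIdx, Set.mem_range, Fin.exists_fin_succ, Fin.val_rev]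
  simp [Fin.ext_iff]
  omega

/-- The coordinates of `v` at the positions dual to `e_4, …, e_n` vanish. -/
def IsTame (n : ℕ) (v : Fin (2 * n + 1) → F) : Prop :=
  ∀ k : Fin (2 * n + 1), 3 ≤ k.val → k.val < n → v k.rev = 0

lemma IsTame.sub {u v : Fin (2 * n + 1) → F} (hu : IsTame n u) (hv : IsTame n v) :
    IsTame n (u - v) := fun k h₁ h₂ => by simp [hu k h₁ h₂, hv k h₁ h₂]

lemma bform_eq_of_isTame (h : 3 ≤ n) {u v : Fin (2 * n + 1) → F} (hu : IsTame n u)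
    (hv : IsTame n v) :
    bform F (2 * n + 1) u v = bform F 7 (u ∘ outerIdx h) (v ∘ outerIdx h) := by
  symm
  refine Fintype.sum_of_injective (outerIdx h) (outerIdx_injective h) _ _ (fun k hk => ?_)
    (fun i => by simp [outerIdx_rev])
  rcases (notMem_range_outerIdx h).1 hk with ⟨h₁, h₂⟩ | ⟨h₁, h₂⟩
  · rw [hv k h₁ h₂, mul_zero]
  · rw [← Fin.rev_rev k, hu _ h₁ h₂, zero_mul]

/-- Extension by zero of a vector indexed by the outer positions. -/
noncomputable def outerExtend (h : 3 ≤ n) (p : Fin 7 → F) : Fin (2 * n + 1) → F :=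
  Function.extend (outerIdx h) p 0

lemma outerExtend_comp (h : 3 ≤ n) (p : Fin 7 → F) : outerExtend h p ∘ outerIdx h = p :=
  Function.extend_comp (outerIdx_injective h) p 0

lemma isTame_outerExtend (h : 3 ≤ n) (p : Fin 7 → F) : IsTame n (outerExtend h p) := by
  intro k h₁ h₂
  refine Function.extend_apply' _ _ _ fun hk => ?_
  refine (notMem_range_outerIdx h).2 (Or.inr ?_) hk
  simpa using ⟨h₁, h₂⟩

/-- The positions of the first, second and last vectors of a family. -/
def specialIdx (h : 3 ≤ n) : Fin 3 → Fin n :=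
  ![⟨0, by omega⟩, ⟨1, by omega⟩, ⟨n - 1, by omega⟩]

lemma specialIdx_injective (h : 3 ≤ n) : Function.Injective (specialIdx h) := by
  intro i j hij
  fin_cases i <;> fin_cases j <;> simp [specialIdx] at hij ⊢ <;> omega

lemma notMem_range_specialIdx (h : 3 ≤ n) {k : Fin n} (hk : k ∉ Set.range (specialIdx h)) :
    2 ≤ k.val ∧ k.val + 1 < n := by
  rcases k with ⟨k, hk'⟩
  simp only [specialIdx, Set.mem_range, Fin.exists_fin_succ] at hk
  simp [Fin.ext_iff] at hk
  simp only
  omega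

open Classical in
/-- The family `p_0, p_1, e_4, …, e_n, p_2`. -/
noncomputable def extendFamily (h : 3 ≤ n) (p : Fin 3 → Fin 7 → F) (k : Fin n) :
    Fin (2 * n + 1) → F :=
  if hk : ∃ i, specialIdx h i = k then outerExtend h (p hk.choose)
  else Pi.single ⟨k.val + 1, by omega⟩ 1

lemma extendFamily_specialIdx (h : 3 ≤ n) (p : Fin 3 → Fin 7 → F) (i : Fin 3) :
    extendFamily h p (specialIdx h i) = outerExtend h (p i) := by
  have hk : ∃ j, specialIdx h j = specialIdx h i := ⟨i, rfl⟩
  rw [extendFamily, dif_pos hk, specialIdx_injective h hk.choose_spec]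

lemma extendFamily_of_notMem (h : 3 ≤ n) (p : Fin 3 → Fin 7 → F) {k : Fin n}
    (hk : k ∉ Set.range (specialIdx h)) :
    extendFamily h p k = Pi.single ⟨k.val + 1, by omega⟩ 1 :=
  dif_neg hk

lemma isTame_extendFamily (h : 3 ≤ n) (p : Fin 3 → Fin 7 → F) (k : Fin n) :
    IsTame n (extendFamily h p k) := by
  by_cases hk : k ∈ Set.range (specialIdx h)
  · obtain ⟨i, rfl⟩ := hk
    rw [extendFamily_specialIdx]
    exact isTame_outerExtend h _
  · rw [extendFamily_of_notMem h p hk]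
    intro l h₁ h₂
    have := notMem_range_specialIdx h hk
    rw [Pi.single_eq_of_ne]
    simp only [ne_eq, Fin.ext_iff, Fin.val_rev]
    omega

lemma extendFamily_comp_of_notMem (h : 3 ≤ n) (p : Fin 3 → Fin 7 → F) {k : Fin n}
    (hk : k ∉ Set.range (specialIdx h)) : extendFamily h p k ∘ outerIdx h = 0 := by
  have := notMem_range_specialIdx h hk
  rw [extendFamily_of_notMem h p hk]
  ext i
  refine Pi.single_eq_of_ne (fun hi => ?_) _
  exact (notMem_range_outerIdx h).2 (Or.inl ⟨by rw [hi]; simp; omega, by rw [hi]; simp; omega⟩)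
    ⟨i, rfl⟩

lemma extendFamily_specialIdx_comp (h : 3 ≤ n) (p : Fin 3 → Fin 7 → F) (i : Fin 3) :
    extendFamily h p (specialIdx h i) ∘ outerIdx h = p i := by
  rw [extendFamily_specialIdx, outerExtend_comp]

lemma bform_extendFamily (h : 3 ≤ n) {p : Fin 3 → Fin 7 → F}
    (hp : ∀ i j, bform F 7 (p i) (p j) = 0) (k l : Fin n) :
    bform F (2 * n + 1) (extendFamily h p k) (extendFamily h p l) = 0 := by
  rw [bform_eq_of_isTame h (isTame_extendFamily h p k) (isTame_extendFamily h p l)]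
  by_cases hk : k ∈ Set.range (specialIdx h)
  · by_cases hl : l ∈ Set.range (specialIdx h)
    · obtain ⟨i, rfl⟩ := hk
      obtain ⟨j, rfl⟩ := hl
      rw [extendFamily_specialIdx_comp, extendFamily_specialIdx_comp, hp]
    · rw [extendFamily_comp_of_notMem h p hl, bform_comm, bform_zero_left]
  · rw [extendFamily_comp_of_notMem h p hk, bform_zero_left]

lemma linearIndependent_extendFamily (h : 3 ≤ n) {p : Fin 3 → Fin 7 → F}
    (hp : LinearIndependent F p) : LinearIndependent F (extendFamily h p) := by
  rw [Fintype.linearIndependent_iff] at hp ⊢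
  intro g hg
  have hspecial : ∀ i, g (specialIdx h i) = 0 := by
    refine hp (fun i => g (specialIdx h i)) ?_
    have h₀ := congrArg (LinearMap.funLeft F F (outerIdx h)) hg
    rw [map_sum, map_zero] at h₀
    rw [← h₀]
    refine Fintype.sum_of_injective (specialIdx h) (specialIdx_injective h) _ _
      (fun k hk => ?_) (fun i => ?_)
    · rw [map_smul]
      exact (congrArg (g k • ·) (extendFamily_comp_of_notMem h p hk)).trans (smul_zero _)
    · rw [map_smul]
      exact (congrArg (g (specialIdx h i) • ·) (extendFamily_specialIdx_comp h p i)).symm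
  intro k
  by_cases hk : k ∈ Set.range (specialIdx h)
  · obtain ⟨i, rfl⟩ := hk
    exact hspecial i
  · have h₀ := congrFun hg ⟨k.val + 1, by omega⟩
    rw [Finset.sum_apply, Finset.sum_eq_single k] at h₀
    · simpa [extendFamily_of_notMem h p hk] using h₀
    · intro l _ hlk
      by_cases hl : l ∈ Set.range (specialIdx h)
      · obtain ⟨i, rfl⟩ := hl
        simp [hspecial i]
      · rw [extendFamily_of_notMem h p hl, Pi.smul_apply, Pi.single_eq_of_ne, smul_zero]
        simp only [ne_eq, Fin.ext_iff] at hlk ⊢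
        omega
    · simp

/-- The span of the first `σ` vectors of `p_0, p_1, e_4, …, e_n, p_2`. -/
noncomputable def familySpan (h : 3 ≤ n) (p : Fin 3 → Fin 7 → F) (σ : ℕ) :
    Submodule F (Fin (2 * n + 1) → F) :=
  initialSpan (extendFamily h p) σ

lemma outerExtend_mem_familySpan (h : 3 ≤ n) (p : Fin 3 → Fin 7 → F) {σ : ℕ} {i : Fin 3}
    (hi : (specialIdx h i).val < σ) : outerExtend h (p i) ∈ familySpan h p σ := by
  rw [← extendFamily_specialIdx]
  exact Submodule.subset_span ⟨_, hi, rfl⟩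

lemma isTame_of_mem_familySpan (h : 3 ≤ n) {p : Fin 3 → Fin 7 → F} {σ : ℕ}
    {v : Fin (2 * n + 1) → F} (hv : v ∈ familySpan h p σ) : IsTame n v := by
  induction hv using Submodule.span_induction with
  | mem x hx => obtain ⟨k, -, rfl⟩ := hx; exact isTame_extendFamily h p k
  | zero => exact fun _ _ _ => rfl
  | add x y _ _ hx hy => exact fun k h₁ h₂ => by simp [hx k h₁ h₂, hy k h₁ h₂]
  | smul a x _ hx => exact fun k h₁ h₂ => by simp [hx k h₁ h₂]

lemma comp_mem_of_mem_familySpan (h : 3 ≤ n) {p : Fin 3 → Fin 7 → F} {σ : ℕ}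
    {T : Submodule F (Fin 7 → F)} (hT : ∀ i, (specialIdx h i).val < σ → p i ∈ T)
    {v : Fin (2 * n + 1) → F} (hv : v ∈ familySpan h p σ) : v ∘ outerIdx h ∈ T := by
  suffices familySpan h p σ ≤ T.comap (LinearMap.funLeft F F (outerIdx h)) from this hv
  refine Submodule.span_le.2 ?_
  rintro _ ⟨k, hk, rfl⟩
  change extendFamily h p k ∘ outerIdx h ∈ T
  by_cases hk' : k ∈ Set.range (specialIdx h)
  · obtain ⟨i, rfl⟩ := hk'
    rw [extendFamily_specialIdx_comp]
    exact hT i hk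
  · rw [extendFamily_comp_of_notMem h p hk']
    exact zero_mem T

lemma exists_comp_eq_of_mem_familySpan (h : 3 ≤ n) {p : Fin 3 → Fin 7 → F} {σ : ℕ}
    (hσ : σ < n) {v : Fin (2 * n + 1) → F} (hv : v ∈ familySpan h p σ) :
    ∃ x y : F, v ∘ outerIdx h = x • p 0 + y • p 1 := by
  have := comp_mem_of_mem_familySpan h (T := Submodule.span F {p 0, p 1}) (fun i hi => ?_) hv
  · obtain ⟨x, y, hxy⟩ := Submodule.mem_span_pair.1 this
    exact ⟨x, y, hxy.symm⟩
  · fin_cases i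
    · exact Submodule.subset_span (by simp)
    · exact Submodule.subset_span (by simp)
    · simp [specialIdx] at hi
      omega

lemma exists_comp_eq_of_mem_familySpan_one (h : 3 ≤ n) {p : Fin 3 → Fin 7 → F}
    {v : Fin (2 * n + 1) → F} (hv : v ∈ familySpan h p 1) :
    ∃ x : F, v ∘ outerIdx h = x • p 0 := by
  have := comp_mem_of_mem_familySpan h (T := Submodule.span F {p 0}) (fun i hi => ?_) hv
  · obtain ⟨x, hx⟩ := Submodule.mem_span_singleton.1 this
    exact ⟨x, hx.symm⟩
  · fin_cases i
    · exact Submodule.subset_span (by simp)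
    · simp [specialIdx] at hi
    · simp [specialIdx] at hi
      omega

lemma exists_comp_eq_of_mem_familySpan_three (h : 3 ≤ n) {p : Fin 3 → Fin 7 → F} {σ : ℕ}
    {v : Fin (2 * n + 1) → F} (hv : v ∈ familySpan h p σ) :
    ∃ x y z : F, v ∘ outerIdx h = x • p 0 + y • p 1 + z • p 2 := by
  have := comp_mem_of_mem_familySpan h (T := Submodule.span F (Set.range p))
    (fun i _ => Submodule.subset_span ⟨i, rfl⟩) hv
  obtain ⟨g, hg⟩ := (Submodule.mem_span_range_iff_exists_fun F).1 this
  exact ⟨g 0, g 1, g 2, by rw [← hg, Fin.sum_univ_three]⟩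

end Family

section Orbits

variable {F : Type*} [Field F]

lemma TripleRel.symm {n p q r : ℕ} {a : Fin p → ℕ} {b : Fin q → ℕ} {c : Fin r → ℕ}
    {x y : FlagVar F n p a × FlagVar F n q b × FlagVar F n r c}
    (h : TripleRel F n p q r a b c x y) : TripleRel F n p q r a b c y x := by
  obtain ⟨g, hg, h₁, h₂, h₃⟩ := h
  have key : ∀ V W : Submodule F (Fin (2 * n + 1) → F),
      Submodule.map g.toLinearMap V = W → Submodule.map g.symm.toLinearMap W = V := by
    rintro V _ rfl
    rw [← Submodule.map_comp]
    simp
  refine ⟨g.symm, fun u v => ?_, fun i => key _ _ (h₁ i), fun i => key _ _ (h₂ i),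
    fun i => key _ _ (h₃ i)⟩
  rw [← hg, g.apply_symm_apply, g.apply_symm_apply]

lemma not_finite_quot_of_invariant {K X : Type*} [Infinite K] {R : X → X → Prop}
    (hR : ∀ x y, R x y → R y x) (I : X → Set K) (hI : ∀ x y, R x y → I x ⊆ I y)
    (f : K → X) (hf : ∀ t, t ∈ I (f t)) (hfin : ∀ t, (I (f t)).Finite) :
    ¬ Finite (Quot R) := by
  intro hQ
  let J : Quot R → Set K :=
    Quot.lift I fun x y hxy => (hI x y hxy).antisymm (hI y x (hR x y hxy))
  obtain ⟨q, hq⟩ := Finite.exists_infinite_fiber fun t => Quot.mk R (f t)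
  have hinf := Set.infinite_coe_iff.1 hq
  obtain ⟨t₀, ht₀⟩ := hinf.nonempty
  refine hinf ((hfin t₀).subset fun t ht => ?_)
  have h₁ : t ∈ J (Quot.mk R (f t)) := hf t
  have h₂ : Quot.mk R (f t) = Quot.mk R (f t₀) := by
    rw [Set.mem_preimage, Set.mem_singleton_iff] at ht ht₀
    rw [ht, ht₀]
  rwa [h₂] at h₁

/-- `u + v` is the component of `w` along `U + V`: the difference is orthogonal to both. -/
def IsComponent {N : ℕ} (U V : Submodule F (Fin N → F)) (w u v : Fin N → F) : Prop :=
  u ∈ U ∧ v ∈ V ∧ ∀ x, x ∈ U ∨ x ∈ V → bform F N (w - u - v) x = 0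

lemma IsComponent.map {N : ℕ} {U V : Submodule F (Fin N → F)} {w u v : Fin N → F}
    (h : IsComponent U V w u v) {g : (Fin N → F) ≃ₗ[F] (Fin N → F)} (hg : IsOrthMap F N g) :
    IsComponent (U.map g.toLinearMap) (V.map g.toLinearMap) (g w) (g u) (g v) := by
  refine ⟨⟨u, h.1, rfl⟩, ⟨v, h.2.1, rfl⟩, ?_⟩
  rintro _ (⟨x, hx, rfl⟩ | ⟨x, hx, rfl⟩)
  · simpa [← map_sub] using (hg _ _).trans (h.2.2 x (Or.inl hx))
  · simpa [← map_sub] using (hg _ _).trans (h.2.2 x (Or.inr hx))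

/-- The values `t` for which some `w, w' ∈ W` with components `(u, v)`, `(u', v')` satisfy
`(u, v) = (u', v') = 0`, `(u', v) = t` and `(u, v') = -1 - t`. -/
def cosquareInvariant {N : ℕ} (U V W : Submodule F (Fin N → F)) : Set F :=
  {t | ∃ w ∈ W, ∃ w' ∈ W, ∃ u v u' v', IsComponent U V w u v ∧ IsComponent U V w' u' v' ∧
    bform F N u v = 0 ∧ bform F N u' v' = 0 ∧ bform F N u' v = t ∧ bform F N u v' = -1 - t}

lemma cosquareInvariant_subset_map {N : ℕ} (U V W : Submodule F (Fin N → F))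
    {g : (Fin N → F) ≃ₗ[F] (Fin N → F)} (hg : IsOrthMap F N g) :
    cosquareInvariant U V W ⊆ cosquareInvariant (U.map g.toLinearMap) (V.map g.toLinearMap)
      (W.map g.toLinearMap) := by
  rintro t ⟨w, hw, w', hw', u, v, u', v', h, h', h₁, h₂, h₃, h₄⟩
  exact ⟨g w, ⟨w, hw, rfl⟩, g w', ⟨w', hw', rfl⟩, g u, g v, g u', g v', h.map hg, h'.map hg,
    by rw [hg, h₁], by rw [hg, h₂], by rw [hg, h₃], by rw [hg, h₄]⟩

/-- The values `t` for which some `w ∈ W₁` with component `(u, v)` and `x, y ∈ W₂` with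
components `(0, v')`, `(u', 0)` satisfy `(u, v) = -t - 2`, `(u', v') = -1`, `(u, v') = -t` and
`(u', v) = -1`. -/
def lineInvariant {N : ℕ} (U V W₁ W₂ : Submodule F (Fin N → F)) : Set F :=
  {t | ∃ w ∈ W₁, ∃ x ∈ W₂, ∃ y ∈ W₂, ∃ u v u' v', IsComponent U V w u v ∧
    IsComponent U V x 0 v' ∧ IsComponent U V y u' 0 ∧ bform F N u v = -t - 2 ∧
    bform F N u' v' = -1 ∧ bform F N u v' = -t ∧ bform F N u' v = -1}

lemma lineInvariant_subset_map {N : ℕ} (U V W₁ W₂ : Submodule F (Fin N → F))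
    {g : (Fin N → F) ≃ₗ[F] (Fin N → F)} (hg : IsOrthMap F N g) :
    lineInvariant U V W₁ W₂ ⊆ lineInvariant (U.map g.toLinearMap) (V.map g.toLinearMap)
      (W₁.map g.toLinearMap) (W₂.map g.toLinearMap) := by
  rintro t ⟨w, hw, x, hx, y, hy, u, v, u', v', h, hx', hy', h₁, h₂, h₃, h₄⟩
  exact ⟨g w, ⟨w, hw, rfl⟩, g x, ⟨x, hx, rfl⟩, g y, ⟨y, hy, rfl⟩, g u, g v, g u', g v',
    h.map hg, by simpa using hx'.map hg, by simpa using hy'.map hg,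
    by rw [hg, h₁], by rw [hg, h₂], by rw [hg, h₃], by rw [hg, h₄]⟩

end Orbits

section Configurations

variable {F : Type*} [Field F] {n : ℕ}

/-- The vectors `e_1, e_2, e_3` in outer coordinates. -/
def leftVectors (F : Type*) [Field F] : Fin 3 → Fin 7 → F :=
  ![![1, 0, 0, 0, 0, 0, 0], ![0, 1, 0, 0, 0, 0, 0], ![0, 0, 1, 0, 0, 0, 0]]

/-- The vectors `e_{2n+1}, e_{2n}, e_{2n-1}` in outer coordinates. -/
def rightVectors (F : Type*) [Field F] : Fin 3 → Fin 7 → F :=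
  ![![0, 0, 0, 0, 0, 0, 1], ![0, 0, 0, 0, 0, 1, 0], ![0, 0, 0, 0, 1, 0, 0]]

/-- A pencil of isotropic planes (the first two vectors), completed to isotropic 3-spaces. -/
def planeVectors (t : F) : Fin 3 → Fin 7 → F :=
  ![![1, 0, 1, 0, 0, t, 0], ![0, 1, 0, 0, 1, 0, -1 - t], ![0, 0, 1, 0, 0, -1, 0]]

/-- A pencil of lines (the first vector) in a fixed isotropic 3-space. -/
def lineVectors (t : F) : Fin 3 → Fin 7 → F :=
  ![![t, 1, 1, 2, t, -2, -1], ![0, 0, 1, 0, 0, 0, -1], ![1, 0, 0, 0, 1, 0, 0]]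

/-- A basis of an isotropic subspace of `F^7`. -/
def IsIsotropicBasis (p : Fin 3 → Fin 7 → F) : Prop :=
  LinearIndependent F p ∧ ∀ i j, bform F 7 (p i) (p j) = 0

lemma isIsotropicBasis_leftVectors : IsIsotropicBasis (leftVectors F) := by
  constructor
  · refine Fintype.linearIndependent_iff.2 fun g hg => ?_
    have h₀ := congrFun hg 0
    have h₁ := congrFun hg 1
    have h₂ := congrFun hg 2
    simp [leftVectors, Fin.sum_univ_three] at h₀ h₁ h₂
    intro i
    fin_cases i <;> assumption
  · intro i j
    fin_cases i <;> fin_cases j <;> simp [leftVectors, bform_seven]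

lemma isIsotropicBasis_rightVectors : IsIsotropicBasis (rightVectors F) := by
  constructor
  · refine Fintype.linearIndependent_iff.2 fun g hg => ?_
    have h₀ := congrFun hg 6
    have h₁ := congrFun hg 5
    have h₂ := congrFun hg 4
    simp [rightVectors, Fin.sum_univ_three] at h₀ h₁ h₂
    intro i
    fin_cases i <;> assumption
  · intro i j
    fin_cases i <;> fin_cases j <;> simp [rightVectors, bform_seven]

lemma isIsotropicBasis_planeVectors (t : F) : IsIsotropicBasis (planeVectors t) := by
  constructor
  · refine Fintype.linearIndependent_iff.2 fun g hg => ?_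
    have h₀ := congrFun hg 0
    have h₁ := congrFun hg 1
    have h₂ := congrFun hg 2
    simp [planeVectors, Fin.sum_univ_three] at h₀ h₁ h₂
    rw [h₀, zero_add] at h₂
    intro i
    fin_cases i <;> assumption
  · intro i j
    fin_cases i <;> fin_cases j <;> (simp [planeVectors, bform_seven]; try ring)

lemma isIsotropicBasis_lineVectors (t : F) : IsIsotropicBasis (lineVectors t) := by
  constructor
  · refine Fintype.linearIndependent_iff.2 fun g hg => ?_
    have h₀ := congrFun hg 1
    have h₁ := congrFun hg 2
    have h₂ := congrFun hg 0
    simp [lineVectors, Fin.sum_univ_three] at h₀ h₁ h₂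
    rw [h₀, zero_add] at h₁
    rw [h₀, zero_mul, zero_add] at h₂
    intro i
    fin_cases i <;> assumption
  · intro i j
    fin_cases i <;> fin_cases j <;> (simp [lineVectors, bform_seven]; try ring)

/-- The flag spanned by initial segments of `p_0, p_1, e_4, …, e_n, p_2`. -/
noncomputable def familyFlag (h : 3 ≤ n) {r : ℕ} (c : Fin r → ℕ) (hc : ∑ i, c i ≤ n)
    {p : Fin 3 → Fin 7 → F} (hp : IsIsotropicBasis p) : FlagVar F n r c :=
  flagOfFamily c hc (extendFamily h p) (linearIndependent_extendFamily h hp.1)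
    (bform_extendFamily h hp.2)

lemma familyFlag_apply (h : 3 ≤ n) {r : ℕ} (c : Fin r → ℕ) (hc : ∑ i, c i ≤ n)
    {p : Fin 3 → Fin 7 → F} (hp : IsIsotropicBasis p) (i : Fin r) :
    (familyFlag h c hc hp).1 i = familySpan h p (∑ j ∈ Finset.Iic i, c j) := rfl

/-- The subspace `⟨e_1, e_2, e_4, …, e_{α+1}⟩` (for `2 ≤ α < n`). -/
noncomputable def leftSpace (F : Type*) [Field F] (h : 3 ≤ n) (α : ℕ) :
    Submodule F (Fin (2 * n + 1) → F) :=
  familySpan h (leftVectors F) α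

/-- The subspace `⟨e_{2n+1}, e_{2n}, e_4, …, e_{β+1}⟩` (for `2 ≤ β < n`). -/
noncomputable def rightSpace (F : Type*) [Field F] (h : 3 ≤ n) (β : ℕ) :
    Submodule F (Fin (2 * n + 1) → F) :=
  familySpan h (rightVectors F) β

lemma exists_of_mem_leftSpace (h : 3 ≤ n) {α : ℕ} (hα : α < n) {u : Fin (2 * n + 1) → F}
    (hu : u ∈ leftSpace F h α) : ∃ x y : F, u ∘ outerIdx h = ![x, y, 0, 0, 0, 0, 0] := by
  obtain ⟨x, y, hxy⟩ := exists_comp_eq_of_mem_familySpan h hα hu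
  exact ⟨x, y, by rw [hxy]; simp [leftVectors]⟩

lemma exists_of_mem_rightSpace (h : 3 ≤ n) {β : ℕ} (hβ : β < n) {v : Fin (2 * n + 1) → F}
    (hv : v ∈ rightSpace F h β) : ∃ x y : F, v ∘ outerIdx h = ![0, 0, 0, 0, 0, y, x] := by
  obtain ⟨x, y, hxy⟩ := exists_comp_eq_of_mem_familySpan h hβ hv
  exact ⟨x, y, by rw [hxy]; simp [rightVectors]⟩

lemma outerExtend_mem_leftSpace (h : 3 ≤ n) {α : ℕ} (hα : 2 ≤ α) (x y : F) :
    outerExtend h ![x, y, 0, 0, 0, 0, 0] ∈ leftSpace F h α := by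
  have h₀ := outerExtend_mem_familySpan h (leftVectors F) (σ := α) (i := 0)
    (by simp [specialIdx]; omega)
  have h₁ := outerExtend_mem_familySpan h (leftVectors F) (σ := α) (i := 1)
    (by simp [specialIdx]; omega)
  have hxy : ![x, y, 0, 0, 0, 0, 0] = x • leftVectors F 0 + y • leftVectors F 1 := by
    simp [leftVectors]
  have hmap : outerExtend h (x • leftVectors F 0 + y • leftVectors F 1) =
      x • outerExtend h (leftVectors F 0) + y • outerExtend h (leftVectors F 1) :=
    (map_add (Function.ExtendByZero.linearMap F (outerIdx h)) _ _).trans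
      (congrArg₂ (· + ·) (map_smul _ x _) (map_smul _ y _))
  rw [hxy, hmap]
  exact add_mem (Submodule.smul_mem _ x h₀) (Submodule.smul_mem _ y h₁)

lemma outerExtend_mem_rightSpace (h : 3 ≤ n) {β : ℕ} (hβ : 2 ≤ β) (x y : F) :
    outerExtend h ![0, 0, 0, 0, 0, y, x] ∈ rightSpace F h β := by
  have h₀ := outerExtend_mem_familySpan h (rightVectors F) (σ := β) (i := 0)
    (by simp [specialIdx]; omega)
  have h₁ := outerExtend_mem_familySpan h (rightVectors F) (σ := β) (i := 1)
    (by simp [specialIdx]; omega)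
  have hxy : ![0, 0, 0, 0, 0, y, x] = x • rightVectors F 0 + y • rightVectors F 1 := by
    simp [rightVectors]
  have hmap : outerExtend h (x • rightVectors F 0 + y • rightVectors F 1) =
      x • outerExtend h (rightVectors F 0) + y • outerExtend h (rightVectors F 1) :=
    (map_add (Function.ExtendByZero.linearMap F (outerIdx h)) _ _).trans
      (congrArg₂ (· + ·) (map_smul _ x _) (map_smul _ y _))
  rw [hxy, hmap]
  exact add_mem (Submodule.smul_mem _ x h₀) (Submodule.smul_mem _ y h₁)

lemma bform_leftSpace_rightSpace (h : 3 ≤ n) {α β : ℕ} {u v : Fin (2 * n + 1) → F}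
    (hu : u ∈ leftSpace F h α) (hv : v ∈ rightSpace F h β) :
    bform F (2 * n + 1) u v = bform F 7 (u ∘ outerIdx h) (v ∘ outerIdx h) :=
  bform_eq_of_isTame h (isTame_of_mem_familySpan h hu) (isTame_of_mem_familySpan h hv)

/-- The component of `w` is read off from its outer coordinates. -/
lemma isComponent_iff (h : 3 ≤ n) {α β : ℕ} (hα : 2 ≤ α) (hα' : α < n) (hβ : 2 ≤ β)
    (hβ' : β < n) {w u v : Fin (2 * n + 1) → F} (hw : IsTame n w) :
    IsComponent (leftSpace F h α) (rightSpace F h β) w u v ↔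
      u ∈ leftSpace F h α ∧ v ∈ rightSpace F h β ∧
        u ∘ outerIdx h = ![w (outerIdx h 0), w (outerIdx h 1), 0, 0, 0, 0, 0] ∧
        v ∘ outerIdx h = ![0, 0, 0, 0, 0, w (outerIdx h 5), w (outerIdx h 6)] := by
  unfold IsComponent
  refine and_congr_right fun hu => and_congr_right fun hv => ?_
  have htame : IsTame n (w - u - v) :=
    (hw.sub (isTame_of_mem_familySpan h hu)).sub (isTame_of_mem_familySpan h hv)
  obtain ⟨a, b, hab⟩ := exists_of_mem_leftSpace h hα' hu
  obtain ⟨c, d, hcd⟩ := exists_of_mem_rightSpace h hβ' hv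
  have hcomp : (w - u - v) ∘ outerIdx h =
      w ∘ outerIdx h - ![a, b, 0, 0, 0, 0, 0] - ![0, 0, 0, 0, 0, d, c] := by
    rw [← hab, ← hcd]; rfl
  rw [hab, hcd]
  constructor
  · intro hx
    have key : ∀ q : Fin 7 → F, outerExtend h q ∈ leftSpace F h α ∨
        outerExtend h q ∈ rightSpace F h β →
        bform F 7 (w ∘ outerIdx h - ![a, b, 0, 0, 0, 0, 0] - ![0, 0, 0, 0, 0, d, c]) q = 0 := by
      intro q hq
      have := hx _ hq
      rwa [bform_eq_of_isTame h htame (isTame_outerExtend h q), outerExtend_comp, hcomp] at this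
    have h₁ := key _ (Or.inl (outerExtend_mem_leftSpace h hα 1 0))
    have h₂ := key _ (Or.inl (outerExtend_mem_leftSpace h hα 0 1))
    have h₃ := key _ (Or.inr (outerExtend_mem_rightSpace h hβ 1 0))
    have h₄ := key _ (Or.inr (outerExtend_mem_rightSpace h hβ 0 1))
    simp only [bform_seven, Pi.sub_apply, Function.comp_apply] at h₁ h₂ h₃ h₄
    simp [sub_eq_zero] at h₁ h₂ h₃ h₄
    rw [h₁, h₂, h₃, h₄]
    exact ⟨rfl, rfl⟩
  · rintro ⟨h₁, h₂⟩ x (hx | hx)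
    · obtain ⟨x₁, x₂, hx'⟩ := exists_of_mem_leftSpace h hα' hx
      rw [bform_eq_of_isTame h htame (isTame_of_mem_familySpan h hx), hx', hcomp, h₁, h₂]
      simp only [bform_seven, Pi.sub_apply, Function.comp_apply]
      simp
    · obtain ⟨x₁, x₂, hx'⟩ := exists_of_mem_rightSpace h hβ' hx
      rw [bform_eq_of_isTame h htame (isTame_of_mem_familySpan h hx), hx', hcomp, h₁, h₂]
      simp only [bform_seven, Pi.sub_apply, Function.comp_apply]
      simp

lemma isComponent_outerExtend (h : 3 ≤ n) {α β : ℕ} (hα : 2 ≤ α) (hα' : α < n) (hβ : 2 ≤ β)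
    (hβ' : β < n) (p : Fin 7 → F) :
    IsComponent (leftSpace F h α) (rightSpace F h β) (outerExtend h p)
      (outerExtend h ![p 0, p 1, 0, 0, 0, 0, 0]) (outerExtend h ![0, 0, 0, 0, 0, p 5, p 6]) := by
  have hp : ∀ i, outerExtend h p (outerIdx h i) = p i := congrFun (outerExtend_comp h p)
  refine (isComponent_iff h hα hα' hβ hβ' (isTame_outerExtend h p)).2
    ⟨outerExtend_mem_leftSpace h hα _ _, outerExtend_mem_rightSpace h hβ _ _, ?_, ?_⟩
  · rw [outerExtend_comp, hp, hp]
  · rw [outerExtend_comp, hp, hp]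

lemma bform_of_isComponent (h : 3 ≤ n) {α β : ℕ} (hα : 2 ≤ α) (hα' : α < n) (hβ : 2 ≤ β)
    (hβ' : β < n) {w w' u v u' v' : Fin (2 * n + 1) → F} (hw : IsTame n w) (hw' : IsTame n w')
    (hc : IsComponent (leftSpace F h α) (rightSpace F h β) w u v)
    (hc' : IsComponent (leftSpace F h α) (rightSpace F h β) w' u' v') :
    bform F (2 * n + 1) u v' =
      w (outerIdx h 0) * w' (outerIdx h 6) + w (outerIdx h 1) * w' (outerIdx h 5) := by
  rw [isComponent_iff h hα hα' hβ hβ' hw] at hc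
  rw [isComponent_iff h hα hα' hβ hβ' hw'] at hc'
  rw [bform_leftSpace_rightSpace h hc.1 hc'.2.1, hc.2.2.1, hc'.2.2.2]
  simp [bform_seven]

lemma bform_outerExtend (h : 3 ≤ n) (p q : Fin 7 → F) :
    bform F (2 * n + 1) (outerExtend h p) (outerExtend h q) = bform F 7 p q := by
  rw [bform_eq_of_isTame h (isTame_outerExtend h p) (isTame_outerExtend h q), outerExtend_comp,
    outerExtend_comp]

lemma mem_cosquareInvariant (h : 3 ≤ n) {α β σ : ℕ} (hα : 2 ≤ α) (hα' : α < n) (hβ : 2 ≤ β)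
    (hβ' : β < n) (hσ : 2 ≤ σ) (t : F) :
    t ∈ cosquareInvariant (leftSpace F h α) (rightSpace F h β)
      (familySpan h (planeVectors t) σ) := by
  refine ⟨_, outerExtend_mem_familySpan h (planeVectors t) (i := 0)
    (by simp [specialIdx]; omega), _, outerExtend_mem_familySpan h (planeVectors t) (i := 1)
    (by simp [specialIdx]; omega), _, _, _, _, isComponent_outerExtend h hα hα' hβ hβ' _,
    isComponent_outerExtend h hα hα' hβ hβ' _, ?_, ?_, ?_, ?_⟩ <;>
  simp [bform_outerExtend, planeVectors, bform_seven]

lemma cosquareInvariant_subset (h : 3 ≤ n) {α β σ : ℕ} (hα : 2 ≤ α) (hα' : α < n)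
    (hβ : 2 ≤ β) (hβ' : β < n) (hσ : σ < n) (t : F) :
    cosquareInvariant (leftSpace F h α) (rightSpace F h β)
      (familySpan h (planeVectors t) σ) ⊆ {t, -1 - t} := by
  rintro s ⟨w, hw, w', hw', u, v, u', v', hc, hc', h₁, h₂, h₃, h₄⟩
  have tw := isTame_of_mem_familySpan h hw
  have tw' := isTame_of_mem_familySpan h hw'
  rw [bform_of_isComponent h hα hα' hβ hβ' tw tw hc hc] at h₁
  rw [bform_of_isComponent h hα hα' hβ hβ' tw' tw' hc' hc'] at h₂
  rw [bform_of_isComponent h hα hα' hβ hβ' tw' tw hc' hc] at h₃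
  rw [bform_of_isComponent h hα hα' hβ hβ' tw tw' hc hc'] at h₄
  obtain ⟨x, y, hxy⟩ := exists_comp_eq_of_mem_familySpan h hσ hw
  obtain ⟨x', y', hxy'⟩ := exists_comp_eq_of_mem_familySpan h hσ hw'
  have e : ∀ i, w (outerIdx h i) = _ := congrFun hxy
  have e' : ∀ i, w' (outerIdx h i) = _ := congrFun hxy'
  simp only [e, e'] at h₁ h₂ h₃ h₄
  simp [planeVectors] at h₁ h₂ h₃ h₄
  have hxy₀ : x * y = 0 := by linear_combination -h₁
  have hxy₀' : x' * y' = 0 := by linear_combination -h₂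
  have hsum : x * y' + x' * y = 1 := by linear_combination -h₃ - h₄
  rcases mul_eq_zero.1 hxy₀ with rfl | rfl
  · right
    have : x' * y = 1 := by simpa using hsum
    rw [Set.mem_singleton_iff]
    linear_combination -h₃ + (-1 - t) * this
  · left
    have : x * y' = 1 := by simpa using hsum
    linear_combination -h₃ + t * this

lemma mem_lineInvariant (h : 3 ≤ n) {α β : ℕ} (hα : 2 ≤ α) (hα' : α < n) (hβ : 2 ≤ β)
    (hβ' : β < n) (t : F) :
    t ∈ lineInvariant (leftSpace F h α) (rightSpace F h β)
      (familySpan h (lineVectors t) 1) (familySpan h (lineVectors t) n) := by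
  have hz : outerExtend h (![0, 0, 0, 0, 0, 0, 0] : Fin 7 → F) = 0 := by
    have : (![0, 0, 0, 0, 0, 0, 0] : Fin 7 → F) = 0 := by
      ext i; fin_cases i <;> rfl
    rw [this]
    exact (Function.ExtendByZero.linearMap F (outerIdx h)).map_zero
  have hx := isComponent_outerExtend h hα hα' hβ hβ' (lineVectors t 1)
  have hy := isComponent_outerExtend h hα hα' hβ hβ' (lineVectors t 2)
  simp only [lineVectors, Matrix.cons_val] at hx hy
  rw [hz] at hx hy
  refine ⟨_, outerExtend_mem_familySpan h (lineVectors t) (i := 0) (by simp [specialIdx]),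
    _, outerExtend_mem_familySpan h (lineVectors t) (i := 1) (by simp [specialIdx]; omega),
    _, outerExtend_mem_familySpan h (lineVectors t) (i := 2) (by simp [specialIdx]; omega),
    _, _, _, _, isComponent_outerExtend h hα hα' hβ hβ' _, hx, hy, ?_, ?_, ?_, ?_⟩ <;>
  simp [bform_outerExtend, lineVectors, bform_seven, sub_eq_add_neg]

lemma lineInvariant_subset (hchar : (2 : F) ≠ 0) (h : 3 ≤ n) {α β : ℕ} (hα : 2 ≤ α)
    (hα' : α < n) (hβ : 2 ≤ β) (hβ' : β < n) (t : F) :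
    lineInvariant (leftSpace F h α) (rightSpace F h β)
      (familySpan h (lineVectors t) 1) (familySpan h (lineVectors t) n) ⊆ {t} := by
  rintro s ⟨w, hw, x, hx, y, hy, u, v, u', v', hc, hcx, hcy, h₁, h₂, h₃, h₄⟩
  have tw := isTame_of_mem_familySpan h hw
  have tx := isTame_of_mem_familySpan h hx
  have ty := isTame_of_mem_familySpan h hy
  rw [bform_of_isComponent h hα hα' hβ hβ' tw tw hc hc] at h₁
  rw [bform_of_isComponent h hα hα' hβ hβ' ty tx hcy hcx] at h₂
  rw [bform_of_isComponent h hα hα' hβ hβ' tw tx hc hcx] at h₃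
  rw [bform_of_isComponent h hα hα' hβ hβ' ty tw hcy hc] at h₄
  have hx₀ := ((isComponent_iff h hα hα' hβ hβ' tx).1 hcx).2.2.1
  have hy₀ := ((isComponent_iff h hα hα' hβ hβ' ty).1 hcy).2.2.2
  have x₀ := congrFun hx₀ 0
  have x₁ := congrFun hx₀ 1
  have y₅ := congrFun hy₀ 5
  have y₆ := congrFun hy₀ 6
  obtain ⟨k, hk⟩ := exists_comp_eq_of_mem_familySpan_one h hw
  obtain ⟨a, b, c, habc⟩ := exists_comp_eq_of_mem_familySpan_three h hx
  obtain ⟨a', b', c', habc'⟩ := exists_comp_eq_of_mem_familySpan_three h hy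
  have ew : ∀ i, w (outerIdx h i) = _ := congrFun hk
  have ex : ∀ i, x (outerIdx h i) = _ := congrFun habc
  have ey : ∀ i, y (outerIdx h i) = _ := congrFun habc'
  simp only [ew, ex, ey] at h₁ h₂ h₃ h₄ x₀ x₁ y₅ y₆
  simp [lineVectors] at h₁ h₂ h₃ h₄ x₀ x₁ y₅ y₆
  have ha : a = 0 := x₁.symm
  have ha' : a' = 0 := y₅.resolve_right hchar
  subst ha ha'
  have hb : b = k := by linear_combination b * h₄ - k * h₂
  have hs : s = k * k * t := by rw [hb] at h₃; linear_combination h₃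
  have hk1 : k * k = 1 := by
    refine mul_left_cancel₀ hchar ?_
    linear_combination -h₁ + hs
  rw [Set.mem_singleton_iff, hs, hk1, one_mul]

end Configurations

section Infinitude

variable {F : Type*} [Field F] [Infinite F] {n r : ℕ}

lemma not_finite_of_plane {α β : ℕ} {c : Fin r → ℕ} (hα : 2 ≤ α) (hα' : α < n) (hβ : 2 ≤ β)
    (hβ' : β < n) (hc : ∑ i, c i ≤ n) (i : Fin r) (hi : 2 ≤ ∑ j ∈ Finset.Iic i, c j)
    (hi' : ∑ j ∈ Finset.Iic i, c j < n) :
    ¬ Finite (Quot (TripleRel F n 1 1 r ![α] ![β] c)) := by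
  have h : 3 ≤ n := by omega
  refine not_finite_quot_of_invariant (K := F) (fun _ _ => TripleRel.symm)
    (fun x => cosquareInvariant (x.1.1 0) (x.2.1.1 0) (x.2.2.1 i)) ?_
    (fun t => (familyFlag h ![α] (by simpa using hα'.le) isIsotropicBasis_leftVectors,
      familyFlag h ![β] (by simpa using hβ'.le) isIsotropicBasis_rightVectors,
      familyFlag h c hc (isIsotropicBasis_planeVectors t))) ?_ ?_
  · rintro x y ⟨g, hg, h₁, h₂, h₃⟩
    simp only [← h₁, ← h₂, ← h₃]
    exact cosquareInvariant_subset_map _ _ _ hg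
  · exact mem_cosquareInvariant h hα hα' hβ hβ' hi
  · exact fun t => (Set.toFinite _).subset (cosquareInvariant_subset h hα hα' hβ hβ' hi' t)

lemma not_finite_of_line (hchar : (2 : F) ≠ 0) {α β : ℕ} {c : Fin r → ℕ} (hα : 2 ≤ α)
    (hα' : α < n) (hβ : 2 ≤ β) (hβ' : β < n) (hc : ∑ i, c i ≤ n) (i j : Fin r)
    (hi : ∑ k ∈ Finset.Iic i, c k = 1) (hj : ∑ k ∈ Finset.Iic j, c k = n) :
    ¬ Finite (Quot (TripleRel F n 1 1 r ![α] ![β] c)) := by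
  have h : 3 ≤ n := by omega
  refine not_finite_quot_of_invariant (K := F) (fun _ _ => TripleRel.symm)
    (fun x => lineInvariant (x.1.1 0) (x.2.1.1 0) (x.2.2.1 i) (x.2.2.1 j)) ?_
    (fun t => (familyFlag h ![α] (by simpa using hα'.le) isIsotropicBasis_leftVectors,
      familyFlag h ![β] (by simpa using hβ'.le) isIsotropicBasis_rightVectors,
      familyFlag h c hc (isIsotropicBasis_lineVectors t))) ?_ ?_
  · rintro x y ⟨g, hg, h₁, h₂, h₃⟩
    simp only [← h₁, ← h₂, ← h₃]
    exact lineInvariant_subset_map _ _ _ _ hg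
  · intro t
    simp only [familyFlag_apply, hi, hj]
    exact mem_lineInvariant h hα hα' hβ hβ' t
  · intro t
    simp only [familyFlag_apply, hi, hj]
    exact (Set.finite_singleton t).subset (lineInvariant_subset hchar h hα hα' hβ hβ' t)

end Infinitude


/-- Proposition 2.15: with `a = (α)`, `b = (β)`, `c = (γ_1,…,γ_r)`,
suppose `M_a × M_b × M_c` has finitely many `O_{2n+1}(F)`-orbits. Then:
(i) if `r = 1` and `α ≤ β ≤ γ_1`, then `α = 1` or `γ_1 = n`;
(ii) if `r ≥ 2` and `α ≤ β`, then `α = 1` or `β = n`. -/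
theorem statement12 (F : Type*) [Field F] [Infinite F] (hchar : (2 : F) ≠ 0)
    (n : ℕ) (hn : 1 ≤ n) (α β : ℕ) (r : ℕ) (hr : 0 < r) (c : Fin r → ℕ)
    (hα : 0 < α) (hβ : 0 < β) (hcpos : ∀ i, 0 < c i)
    (hαn : α ≤ n) (hβn : β ≤ n) (hcsum : (∑ i, c i) ≤ n)
    (hfin : Finite (Quot (TripleRel F n 1 1 r ![α] ![β] c))) :
    (r = 1 → α ≤ β → β ≤ c ⟨0, hr⟩ → (α = 1 ∨ c ⟨0, hr⟩ = n)) ∧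
      (2 ≤ r → α ≤ β → (α = 1 ∨ β = n)) := by
  constructor
  · rintro rfl hαβ hβc
    by_contra! hne
    have hsum : ∑ j ∈ Finset.Iic (0 : Fin 1), c j = c 0 := by
      rw [show Finset.Iic (0 : Fin 1) = {0} from rfl]
      simp
    have hc0 : c ⟨0, hr⟩ = c 0 := rfl
    have hcn : c 0 ≤ n := by simpa using hcsum
    exact not_finite_of_plane (by omega) (by omega) (by omega) (by omega) hcsum 0
      (by omega) (by omega) hfin
  · intro hr2 hαβ
    by_contra! hne
    have hα2 : 2 ≤ α := by omega
    have hα' : α < n := by omega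
    have hβ2 : 2 ≤ β := by omega
    have hβ' : β < n := by omega
    by_cases hmid : ∃ i, 2 ≤ ∑ j ∈ Finset.Iic i, c j ∧ ∑ j ∈ Finset.Iic i, c j < n
    · obtain ⟨i, hi, hi'⟩ := hmid
      exact not_finite_of_plane hα2 hα' hβ2 hβ' hcsum i hi hi' hfin
    · push Not at hmid
      have hle : ∀ i, ∑ j ∈ Finset.Iic i, c j ≤ n := fun i =>
        (Finset.sum_le_sum_of_subset (Finset.subset_univ _)).trans hcsum
      have hpos : ∀ i, 1 ≤ ∑ j ∈ Finset.Iic i, c j := fun i =>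
        (hcpos i).trans_le
          (Finset.single_le_sum (fun _ _ => Nat.zero_le _) (Finset.mem_Iic.2 le_rfl))
      have hlt : ∑ j ∈ Finset.Iic (⟨0, hr⟩ : Fin r), c j <
          ∑ j ∈ Finset.Iic (⟨1, hr2⟩ : Fin r), c j :=
        Finset.sum_lt_sum_of_subset (i := ⟨1, hr2⟩)
          (Finset.Iic_subset_Iic.2 (Fin.mk_le_mk.2 zero_le_one))
          (Finset.mem_Iic.2 le_rfl) (by rw [Finset.mem_Iic, Fin.mk_le_mk]; omega)
          (hcpos _) (fun _ _ _ => Nat.zero_le _)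
      have h₀ := hmid ⟨0, hr⟩
      have h₁ := hmid ⟨1, hr2⟩
      have := hle ⟨0, hr⟩
      have := hle ⟨1, hr2⟩
      have := hpos ⟨0, hr⟩
      exact not_finite_of_line hchar hα2 hα' hβ2 hβ' hcsum ⟨0, hr⟩ ⟨1, hr2⟩ (by omega)
        (by omega) hfin
end

section
/- Let F be an infinite field with char F ≠ 2 and let n ≥ 1. Let a = (α_1), b = (β_1), c = (γ_1, …, γ_r) be sequences of positive integers with sums at most n, with r ≥ 3 and α_1 ≤ β_1. If the set of G-orbits on M_a × M_b × M_c under the diagonal action of G = O_{2n+1}(F) is finite, then α_1 = 1 or α_1 = β_1 = n. -/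
open Module

namespace OrthTriple

variable {F : Type*} [Field F] {n : ℕ}

/-- The `k`-th coordinate of a vector of `F^{2n+1}`, read as `0` when `k` is out of range. -/
def coord (F : Type*) [Field F] (n k : ℕ) : (Fin (2*n+1) → F) →ₗ[F] F where
  toFun x := if h : k < 2*n+1 then x ⟨k, h⟩ else 0
  map_add' x y := by split_ifs <;> simp
  map_smul' c x := by split_ifs <;> simp

/-- The `k`-th standard basis vector, counted from `0`. -/
def basisVec (F : Type*) [Field F] (n k : ℕ) : Fin (2*n+1) → F :=
  fun i => if i.val = k then 1 else 0

/-- The span of the standard basis vectors with index in `T`. -/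
def coordSub (F : Type*) [Field F] (n : ℕ) (T : Finset ℕ) : Submodule F (Fin (2*n+1) → F) where
  carrier := {x | ∀ k, k ∉ T → coord F n k x = 0}
  add_mem' hx hy k hk := by rw [map_add, hx k hk, hy k hk, add_zero]
  zero_mem' k _ := map_zero _
  smul_mem' c x hx k hk := by rw [map_smul, hx k hk, smul_zero]

theorem coord_basisVec_self {k : ℕ} (h : k < 2*n+1) : coord F n k (basisVec F n k) = 1 := by
  simp [coord, basisVec, h]

theorem coord_basisVec_of_ne {j k : ℕ} (h : j ≠ k) : coord F n j (basisVec F n k) = 0 := by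
  simp [coord, basisVec, h]

theorem coord_val (x : Fin (2*n+1) → F) (i : Fin (2*n+1)) : coord F n i x = x i :=
  dif_pos i.isLt

theorem basisVec_mem {T : Finset ℕ} {k : ℕ} (h : k ∈ T) :
    basisVec F n k ∈ coordSub F n T := fun _ hj =>
  coord_basisVec_of_ne (fun hjk => hj (hjk ▸ h))

theorem coordSub_mono {S T : Finset ℕ} (h : S ⊆ T) : coordSub F n S ≤ coordSub F n T :=
  fun _ hx k hk => hx k (fun hS => hk (h hS))

theorem finrank_coordSub {T : Finset ℕ} (h : ∀ k ∈ T, k < 2*n+1) :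
    finrank F (coordSub F n T) = T.card := by
  let φ : coordSub F n T ≃ₗ[F] (T → F) :=
    { toFun := fun x k => coord F n k x.1
      map_add' := fun x y => by ext; simp
      map_smul' := fun c x => by ext; simp
      invFun := fun f => ⟨fun i => if hi : i.val ∈ T then f ⟨i.val, hi⟩ else 0, fun k hk => by
        simp [coord, hk]⟩
      left_inv := fun x => by
        ext i
        by_cases hi : i.val ∈ T
        · simp [hi, coord_val]
        · simpa [hi, coord_val] using (x.2 _ hi).symm
      right_inv := fun f => by
        ext k
        simp [coord, h k.1 k.2] }
  rw [φ.finrank_eq, Module.finrank_fintype_fun_eq_card, Fintype.card_coe]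

theorem bform_comm (x y : Fin (2*n+1) → F) :
    bform F (2*n+1) x y = bform F (2*n+1) y x := by
  unfold bform
  rw [← Equiv.sum_comp Fin.revPerm]
  simp [mul_comm]

theorem bform_add_right (x y z : Fin (2*n+1) → F) :
    bform F (2*n+1) x (y + z) = bform F (2*n+1) x y + bform F (2*n+1) x z := by
  simp [bform, mul_add, Finset.sum_add_distrib]

theorem bform_smul_right (c : F) (x y : Fin (2*n+1) → F) :
    bform F (2*n+1) x (c • y) = c * bform F (2*n+1) x y := by
  simp [bform, Finset.mul_sum, mul_left_comm]

theorem bform_basisVec_right {k : ℕ} (hk : k ≤ 2*n) (x : Fin (2*n+1) → F) :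
    bform F (2*n+1) x (basisVec F n k) = coord F n (2*n-k) x := by
  unfold bform
  rw [Finset.sum_eq_single (⟨2*n-k, by omega⟩ : Fin (2*n+1))]
  · have h : 2*n+1 - (2*n-k+1) = k := by omega
    simp [basisVec, coord, Fin.rev, h, show 2*n-k < 2*n+1 by omega]
  · intro i _ hi
    have : (i.rev : ℕ) ≠ k := by
      intro h
      apply hi
      ext
      simp only [Fin.val_rev] at h
      simp only
      omega
    rw [basisVec, if_neg this, mul_zero]
  · simp

theorem isIsotropic_coordSub {T : Finset ℕ} (h : ∀ k ∈ T, k ≤ 2*n → 2*n-k ∉ T) :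
    IsIsotropic F (2*n+1) (coordSub F n T) := by
  intro x hx y hy
  refine Finset.sum_eq_zero fun i _ => ?_
  by_cases hi : i.val ∈ T
  · have := hy _ (h _ hi (by omega))
    have hr : (i.rev : ℕ) = 2*n - i := by simp only [Fin.val_rev]; omega
    rw [← hr, coord_val] at this
    rw [this, mul_zero]
  · have := hx _ hi
    rw [coord_val] at this
    rw [this, zero_mul]

/-- The span of `u`, `w` and the standard basis vectors with index in `T`. -/
def extSub (u w : Fin (2*n+1) → F) (T : Finset ℕ) : Submodule F (Fin (2*n+1) → F) :=
  Submodule.span F {u, w} ⊔ coordSub F n T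

theorem mem_extSub {u w : Fin (2*n+1) → F} {T : Finset ℕ} {x : Fin (2*n+1) → F} :
    x ∈ extSub u w T ↔ ∃ p q : F, ∃ a ∈ coordSub F n T, x = p • u + q • w + a := by
  unfold extSub
  simp only [Submodule.mem_sup, Submodule.mem_span_pair]
  constructor
  · rintro ⟨y, ⟨p, q, rfl⟩, a, ha, rfl⟩
    exact ⟨p, q, a, ha, rfl⟩
  · rintro ⟨p, q, a, ha, rfl⟩
    exact ⟨_, ⟨p, q, rfl⟩, a, ha, rfl⟩

theorem left_mem_extSub (u w : Fin (2*n+1) → F) (T : Finset ℕ) : u ∈ extSub u w T :=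
  mem_extSub.2 ⟨1, 0, 0, zero_mem _, by simp⟩

theorem right_mem_extSub (u w : Fin (2*n+1) → F) (T : Finset ℕ) : w ∈ extSub u w T :=
  mem_extSub.2 ⟨0, 1, 0, zero_mem _, by simp⟩

theorem finrank_extSub {u w : Fin (2*n+1) → F} {T : Finset ℕ} (h : ∀ k ∈ T, k < 2*n+1)
    {i j : ℕ} (hi : i ∉ T) (hj : j ∉ T) (hui : coord F n i u = 1) (hwi : coord F n i w = 0)
    (huj : coord F n j u = 0) (hwj : coord F n j w = 1) :
    finrank F (extSub u w T) = T.card + 2 := by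
  have hli : LinearIndependent F ![u, w] := by
    rw [LinearIndependent.pair_iff]
    intro p q hpq
    have h1 := congrArg (coord F n i) hpq
    have h2 := congrArg (coord F n j) hpq
    simp [hui, hwi, huj, hwj] at h1 h2
    exact ⟨h1, h2⟩
  have h2 : finrank F (Submodule.span F {u, w}) = 2 := by
    have := finrank_span_eq_card hli
    rwa [Matrix.range_cons_cons_empty, Fintype.card_fin] at this
  have hinf : Submodule.span F {u, w} ⊓ coordSub F n T = ⊥ := by
    rw [Submodule.eq_bot_iff]
    rintro x ⟨hx, hxT⟩
    obtain ⟨p, q, rfl⟩ := Submodule.mem_span_pair.1 hx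
    have h1 := hxT i hi
    have h2 := hxT j hj
    simp [hui, hwi, huj, hwj] at h1 h2
    simp [h1, h2]
  have := Submodule.finrank_sup_add_finrank_inf_eq (Submodule.span F {u, w}) (coordSub F n T)
  rw [hinf, finrank_bot, h2, finrank_coordSub h] at this
  unfold extSub
  omega

theorem isIsotropic_extSub {u w : Fin (2*n+1) → F} {T : Finset ℕ}
    (hT : IsIsotropic F (2*n+1) (coordSub F n T))
    (huu : bform F (2*n+1) u u = 0) (huw : bform F (2*n+1) u w = 0)
    (hww : bform F (2*n+1) w w = 0) (hu : ∀ a ∈ coordSub F n T, bform F (2*n+1) a u = 0)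
    (hw : ∀ a ∈ coordSub F n T, bform F (2*n+1) a w = 0) :
    IsIsotropic F (2*n+1) (extSub u w T) := by
  intro x hx y hy
  obtain ⟨p, q, a, ha, rfl⟩ := mem_extSub.1 hx
  obtain ⟨p', q', a', ha', rfl⟩ := mem_extSub.1 hy
  have expand (z) : bform F (2*n+1) z (p' • u + q' • w + a') =
      p' * bform F (2*n+1) z u + q' * bform F (2*n+1) z w + bform F (2*n+1) z a' := by
    rw [bform_add_right, bform_add_right, bform_smul_right, bform_smul_right]
  have expand' (z) : bform F (2*n+1) (p • u + q • w + a) z =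
      p * bform F (2*n+1) z u + q * bform F (2*n+1) z w + bform F (2*n+1) z a := by
    rw [bform_comm, bform_add_right, bform_add_right, bform_smul_right, bform_smul_right]
  rw [expand, expand', expand', expand', huu, hww, bform_comm w u, huw, bform_comm u a,
    bform_comm w a, hu _ ha, hw _ ha, hu _ ha', hw _ ha', hT _ ha' _ ha]
  ring

theorem bform_map_eq {g : (Fin (2*n+1) → F) ≃ₗ[F] (Fin (2*n+1) → F)}
    (hg : IsOrthMap F (2*n+1) g) (x y : Fin (2*n+1) → F) :
    bform F (2*n+1) (g x) y = bform F (2*n+1) x (g.symm y) := by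
  rw [← hg x, g.apply_symm_apply]

theorem bform_symm_eq {g : (Fin (2*n+1) → F) ≃ₗ[F] (Fin (2*n+1) → F)}
    (hg : IsOrthMap F (2*n+1) g) (x y : Fin (2*n+1) → F) :
    bform F (2*n+1) (g.symm x) y = bform F (2*n+1) x (g y) := by
  rw [← hg, g.apply_symm_apply]

theorem tripleRel_equivalence (p q r : ℕ) (a : Fin p → ℕ) (b : Fin q → ℕ) (c : Fin r → ℕ) :
    Equivalence (TripleRel F n p q r a b c) where
  refl x := ⟨LinearEquiv.refl F _, fun _ _ => rfl, fun _ => Submodule.map_id _,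
    fun _ => Submodule.map_id _, fun _ => Submodule.map_id _⟩
  symm := by
    rintro x y ⟨g, hg, h1, h2, h3⟩
    have key (S T : Submodule F (Fin (2*n+1) → F)) (h : S.map g.toLinearMap = T) :
        T.map g.symm.toLinearMap = S := by
      subst h
      rw [← Submodule.map_comp]
      simp
    refine ⟨g.symm, fun u v => ?_, fun i => key _ _ (h1 i), fun i => key _ _ (h2 i),
      fun i => key _ _ (h3 i)⟩
    rw [bform_symm_eq hg, g.apply_symm_apply]
  trans := by
    rintro x y z ⟨g, hg, h1, h2, h3⟩ ⟨g', hg', h1', h2', h3'⟩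
    refine ⟨g.trans g', fun u v => ?_, fun i => ?_, fun i => ?_, fun i => ?_⟩
    · rw [LinearEquiv.trans_apply, LinearEquiv.trans_apply, hg', hg]
    · rw [← h1', ← h1, ← Submodule.map_comp]; rfl
    · rw [← h2', ← h2, ← Submodule.map_comp]; rfl
    · rw [← h3', ← h3, ← Submodule.map_comp]; rfl

/-- First vector of the family of planes used when `β < n`. -/
def planeFst (F : Type*) [Field F] (n : ℕ) (t : F) : Fin (2*n+1) → F :=
  (-2 : F) • basisVec F n 0 + t • basisVec F n 1 + (-2 : F) • basisVec F n 2
    + (2 : F) • basisVec F n n + basisVec F n (2*n)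

/-- Second vector of the family of planes used when `β < n`. -/
def planeSnd (F : Type*) [Field F] (n : ℕ) : Fin (2*n+1) → F :=
  (2 : F) • basisVec F n 0 + basisVec F n 1 + basisVec F n (2*n-2)

/-- First vector of the family of planes used when `β = n`. -/
def maxPlaneFst (F : Type*) [Field F] (n : ℕ) (t : F) : Fin (2*n+1) → F :=
  t • basisVec F n 1 + basisVec F n 2 + basisVec F n (2*n)

/-- Second vector of the family of planes used when `β = n`. -/
def maxPlaneSnd (F : Type*) [Field F] (n : ℕ) (t : F) : Fin (2*n+1) → F :=
  (-t) • basisVec F n 0 + (-2 : F) • basisVec F n 1 + (-1 : F) • basisVec F n 2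
    + (2 : F) • basisVec F n n + basisVec F n (2*n-1)

theorem bform_planeFst (hn : 3 ≤ n) (t : F) (x : Fin (2*n+1) → F) :
    bform F (2*n+1) x (planeFst F n t) = -2 * coord F n (2*n) x + t * coord F n (2*n-1) x
      - 2 * coord F n (2*n-2) x + 2 * coord F n n x + coord F n 0 x := by
  have h : 2*n-n = n := by omega
  simp (disch := omega) only [planeFst, bform_add_right, bform_smul_right, bform_basisVec_right,
    h, Nat.sub_self, Nat.sub_zero]
  ring

theorem bform_planeSnd (hn : 3 ≤ n) (x : Fin (2*n+1) → F) :
    bform F (2*n+1) x (planeSnd F n) =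
      2 * coord F n (2*n) x + coord F n (2*n-1) x + coord F n 2 x := by
  have h : 2*n-(2*n-2) = 2 := by omega
  simp (disch := omega) only [planeSnd, bform_add_right, bform_smul_right, bform_basisVec_right,
    h, Nat.sub_zero]

theorem bform_maxPlaneFst (hn : 3 ≤ n) (t : F) (x : Fin (2*n+1) → F) :
    bform F (2*n+1) x (maxPlaneFst F n t) =
      t * coord F n (2*n-1) x + coord F n (2*n-2) x + coord F n 0 x := by
  simp (disch := omega) only [maxPlaneFst, bform_add_right, bform_smul_right,
    bform_basisVec_right, Nat.sub_self]

theorem bform_maxPlaneSnd (hn : 3 ≤ n) (t : F) (x : Fin (2*n+1) → F) :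
    bform F (2*n+1) x (maxPlaneSnd F n t) = -t * coord F n (2*n) x - 2 * coord F n (2*n-1) x
      - coord F n (2*n-2) x + 2 * coord F n n x + coord F n 1 x := by
  have h : 2*n-n = n := by omega
  have h' : 2*n-(2*n-1) = 1 := by omega
  simp (disch := omega) only [maxPlaneSnd, bform_add_right, bform_smul_right,
    bform_basisVec_right, h, h', Nat.sub_zero]
  ring

theorem isIsotropic_plane (hn : 3 ≤ n) (t : F) {T : Finset ℕ} (hT : ∀ k ∈ T, 3 ≤ k ∧ k < n) :
    IsIsotropic F (2*n+1) (extSub (planeFst F n t) (planeSnd F n) T) := by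
  apply isIsotropic_extSub
  · refine isIsotropic_coordSub fun k hk _ hk' => ?_
    have := hT _ hk
    have := hT _ hk'
    omega
  · rw [bform_planeFst hn]
    simp (disch := omega) only [planeFst, map_add, map_smul, coord_basisVec_self,
      coord_basisVec_of_ne, smul_eq_mul]
    ring
  · rw [bform_planeSnd hn]
    simp (disch := omega) only [planeFst, map_add, map_smul, coord_basisVec_self,
      coord_basisVec_of_ne, smul_eq_mul]
    ring
  · rw [bform_planeSnd hn]
    simp (disch := omega) only [planeSnd, map_add, map_smul, coord_basisVec_of_ne,
      smul_eq_mul]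
    ring
  · intro a ha
    have h (k) (hk : ¬ (3 ≤ k ∧ k < n)) := ha k (fun h => hk (hT k h))
    simp (disch := omega) only [bform_planeFst hn, h]
    ring
  · intro a ha
    have h (k) (hk : ¬ (3 ≤ k ∧ k < n)) := ha k (fun h => hk (hT k h))
    simp (disch := omega) only [bform_planeSnd hn, h]
    ring

theorem isIsotropic_maxPlane (hn : 3 ≤ n) (t : F) {T : Finset ℕ}
    (hT : ∀ k ∈ T, 3 ≤ k ∧ k < n) :
    IsIsotropic F (2*n+1) (extSub (maxPlaneFst F n t) (maxPlaneSnd F n t) T) := by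
  apply isIsotropic_extSub
  · refine isIsotropic_coordSub fun k hk _ hk' => ?_
    have := hT _ hk
    have := hT _ hk'
    omega
  · rw [bform_maxPlaneFst hn]
    simp (disch := omega) only [maxPlaneFst, map_add, map_smul, coord_basisVec_of_ne,
      smul_eq_mul]
    ring
  · rw [bform_maxPlaneSnd hn]
    simp (disch := omega) only [maxPlaneFst, map_add, map_smul, coord_basisVec_self,
      coord_basisVec_of_ne, smul_eq_mul]
    ring
  · rw [bform_maxPlaneSnd hn]
    simp (disch := omega) only [maxPlaneSnd, map_add, map_smul, coord_basisVec_self,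
      coord_basisVec_of_ne, smul_eq_mul]
    ring
  · intro a ha
    have h (k) (hk : ¬ (3 ≤ k ∧ k < n)) := ha k (fun h => hk (hT k h))
    simp (disch := omega) only [bform_maxPlaneFst hn, h]
    ring
  · intro a ha
    have h (k) (hk : ¬ (3 ≤ k ∧ k < n)) := ha k (fun h => hk (hT k h))
    simp (disch := omega) only [bform_maxPlaneSnd hn, h]
    ring

theorem finrank_plane (hn : 3 ≤ n) (t : F) {T : Finset ℕ} (hT : ∀ k ∈ T, 3 ≤ k ∧ k < n) :
    finrank F (extSub (planeFst F n t) (planeSnd F n) T) = T.card + 2 := by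
  refine finrank_extSub (i := 2*n) (j := 2*n-2) (fun k hk => by have := hT k hk; omega)
    (fun hk => by have := hT _ hk; omega) (fun hk => by have := hT _ hk; omega) ?_ ?_ ?_ ?_ <;>
  · simp (disch := omega) only [planeFst, planeSnd, map_add, map_smul, coord_basisVec_self,
      coord_basisVec_of_ne, smul_eq_mul]
    ring

theorem finrank_maxPlane (hn : 3 ≤ n) (t : F) {T : Finset ℕ} (hT : ∀ k ∈ T, 3 ≤ k ∧ k < n) :
    finrank F (extSub (maxPlaneFst F n t) (maxPlaneSnd F n t) T) = T.card + 2 := by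
  refine finrank_extSub (i := 2*n) (j := 2*n-1) (fun k hk => by have := hT k hk; omega)
    (fun hk => by have := hT _ hk; omega) (fun hk => by have := hT _ hk; omega) ?_ ?_ ?_ ?_ <;>
  · simp (disch := omega) only [maxPlaneFst, maxPlaneSnd, map_add, map_smul, coord_basisVec_self,
      coord_basisVec_of_ne, smul_eq_mul]
    ring

/-- The parameter of the family of planes is an invariant of the triple when `β < n`. -/
theorem plane_param_eq (hchar : (2 : F) ≠ 0) (hn : 3 ≤ n) {t s : F}
    {g : (Fin (2*n+1) → F) ≃ₗ[F] (Fin (2*n+1) → F)} (hg : IsOrthMap F (2*n+1) g)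
    {TA TB T₁ T₃ : Finset ℕ} (hTA : ∀ k ∈ TA, 3 ≤ k ∧ k < n)
    (hTB : ∀ k ∈ TB, (3 ≤ k ∧ k < n) ∨ k = 2*n-1 ∨ k = 2*n)
    (hB₁ : 2*n-1 ∈ TB) (hB₂ : 2*n ∈ TB)
    (hT₁ : ∀ k ∈ T₁, k = 0 ∨ (3 ≤ k ∧ k < n)) (h₁ : 0 ∈ T₁)
    (hT₃ : ∀ k ∈ T₃, k < n) (h₃₁ : 1 ∈ T₃) (h₃₂ : 2 ∈ T₃)
    (hA : ∀ x, g x ∈ extSub (planeFst F n s) (planeSnd F n) TA ↔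
      x ∈ extSub (planeFst F n t) (planeSnd F n) TA)
    (hB : ∀ x, g x ∈ coordSub F n TB ↔ x ∈ coordSub F n TB)
    (hC₁ : ∀ x, g x ∈ coordSub F n T₁ ↔ x ∈ coordSub F n T₁)
    (hC₃ : ∀ x, g x ∈ coordSub F n T₃ ↔ x ∈ coordSub F n T₃) : t = s := by
  have zA {x} (hx : x ∈ coordSub F n TA) (k) (hk : ¬ (3 ≤ k ∧ k < n)) : coord F n k x = 0 :=
    hx k fun h => hk (hTA k h)
  have zB {x} (hx : x ∈ coordSub F n TB) (k) (hk : ¬ ((3 ≤ k ∧ k < n) ∨ k = 2*n-1 ∨ k = 2*n)) :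
      coord F n k x = 0 := hx k fun h => hk (hTB k h)
  have z₁ {x} (hx : x ∈ coordSub F n T₁) (k) (hk : ¬ (k = 0 ∨ (3 ≤ k ∧ k < n))) :
      coord F n k x = 0 := hx k fun h => hk (hT₁ k h)
  have z₃ {x} (hx : x ∈ coordSub F n T₃) (k) (hk : ¬ (k < n)) :
      coord F n k x = 0 := hx k fun h => hk (hT₃ k h)
  have sub₂ : 2*n-(2*n-1) = 1 := by omega
  obtain ⟨p, q, a, ha, hu⟩ := mem_extSub.1 ((hA _).2 (left_mem_extSub _ _ _))
  obtain ⟨p', q', a', ha', hw⟩ := mem_extSub.1 ((hA _).2 (right_mem_extSub _ _ _))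
  -- `g u ⊥ e₂`, since `u ⊥ C₃ ∩ B^⊥`
  have hq : q = 0 := by
    have h : bform F (2*n+1) (g (planeFst F n t)) (basisVec F n 2) = 0 := by
      rw [bform_map_eq hg, bform_comm]
      have hy₃ : g.symm (basisVec F n 2) ∈ coordSub F n T₃ :=
        (hC₃ _).1 (by rw [g.apply_symm_apply]; exact basisVec_mem h₃₂)
      have hyB (b) (hb : b ∈ coordSub F n TB) :
          bform F (2*n+1) b (g.symm (basisVec F n 2)) = 0 := by
        rw [← bform_map_eq hg, bform_basisVec_right (by omega)]
        exact zB ((hB _).2 hb) _ (by omega)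
      have e₀ := hyB _ (basisVec_mem hB₂)
      have e₁ := hyB _ (basisVec_mem hB₁)
      rw [bform_comm, bform_basisVec_right (by omega)] at e₀ e₁
      rw [Nat.sub_self] at e₀
      simp (disch := omega) only [bform_planeFst hn, z₃ hy₃, e₀]
      ring
    rw [hu, bform_basisVec_right (by omega)] at h
    simp (disch := omega) only [planeFst, planeSnd, map_add, map_smul, coord_basisVec_self,
      coord_basisVec_of_ne, smul_eq_mul, zA ha] at h
    linear_combination h
  have hp' : p' = 0 := by
    have h : bform F (2*n+1) (g (planeSnd F n)) (basisVec F n 0) = 0 := by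
      rw [bform_map_eq hg, bform_comm]
      have hy := (hC₁ (g.symm (basisVec F n 0))).1
        (by rw [g.apply_symm_apply]; exact basisVec_mem h₁)
      simp (disch := omega) only [bform_planeSnd hn, z₁ hy]
      ring
    rw [hw, bform_basisVec_right (by omega)] at h
    simp (disch := omega) only [planeFst, planeSnd, map_add, map_smul, coord_basisVec_self,
      coord_basisVec_of_ne, smul_eq_mul, zA ha', Nat.sub_zero] at h
    linear_combination h
  subst hq hp'
  have hpq : p = q' := by
    have h : bform F (2*n+1) (g (planeFst F n t + planeSnd F n)) (basisVec F n (2*n)) = 0 := by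
      rw [bform_map_eq hg, bform_comm]
      have hyB := (hB (g.symm (basisVec F n (2*n)))).1
        (by rw [g.apply_symm_apply]; exact basisVec_mem hB₂)
      have hy : bform F (2*n+1) (g.symm (basisVec F n (2*n))) (basisVec F n 1) = 0 := by
        rw [bform_symm_eq hg, bform_comm, bform_basisVec_right le_rfl, Nat.sub_self]
        have hx₃ := (hC₃ (basisVec F n 1)).2 (basisVec_mem h₃₁)
        have hxA : bform F (2*n+1) (g (basisVec F n 1)) (planeFst F n s) = 0 := by
          rw [bform_map_eq hg, bform_comm]
          obtain ⟨x, y, z, hz, hxyz⟩ := mem_extSub.1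
            ((hA (g.symm (planeFst F n s))).1
              (by rw [g.apply_symm_apply]; exact left_mem_extSub _ _ _))
          rw [hxyz, bform_basisVec_right (by omega)]
          simp (disch := omega) only [planeFst, planeSnd, map_add, map_smul,
            coord_basisVec_of_ne, smul_eq_mul, zA hz]
          ring
        simp (disch := omega) only [bform_planeFst hn, z₃ hx₃] at hxA
        linear_combination hxA
      rw [bform_basisVec_right (by omega)] at hy
      simp (disch := omega) only [bform_add_right, bform_planeFst hn, bform_planeSnd hn, zB hyB,
        hy]
      ring
    rw [map_add, hu, hw, bform_basisVec_right le_rfl, Nat.sub_self] at h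
    simp (disch := omega) only [planeFst, planeSnd, map_add, map_smul, coord_basisVec_self,
      coord_basisVec_of_ne, smul_eq_mul, zA ha', zA ha] at h
    apply mul_left_cancel₀ hchar
    linear_combination -h
  subst hpq
  have hst : p * (s - t) = 0 := by
    have h : bform F (2*n+1) (g (planeFst F n t + (-t) • planeSnd F n))
        (basisVec F n (2*n-1)) = 0 := by
      rw [bform_map_eq hg, bform_comm]
      have hyB := (hB (g.symm (basisVec F n (2*n-1)))).1
        (by rw [g.apply_symm_apply]; exact basisVec_mem hB₁)
      have hy : bform F (2*n+1) (g.symm (basisVec F n (2*n-1))) (basisVec F n 0) = 0 := by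
        rw [bform_symm_eq hg, bform_comm, bform_basisVec_right (by omega), sub₂]
        exact z₁ ((hC₁ _).2 (basisVec_mem h₁)) _ (by omega)
      rw [bform_basisVec_right (by omega), Nat.sub_zero] at hy
      simp (disch := omega) only [bform_add_right, bform_smul_right, bform_planeFst hn,
        bform_planeSnd hn, zB hyB, hy]
      ring
    rw [map_add, map_smul, hu, hw, bform_basisVec_right (by omega), sub₂] at h
    simp (disch := omega) only [planeFst, planeSnd, map_add, map_smul, coord_basisVec_self,
      coord_basisVec_of_ne, smul_eq_mul, zA ha', zA ha] at h
    linear_combination h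
  have hp : p ≠ 0 := by
    rintro rfl
    have h : bform F (2*n+1) (g (planeFst F n t)) (g (basisVec F n 0)) = 0 := by
      rw [hu, bform_comm]
      have hy := (hC₁ (basisVec F n 0)).2 (basisVec_mem h₁)
      refine isIsotropic_coordSub (T := T₁ ∪ TA) (fun k hk _ hk' => ?_) _
        (coordSub_mono Finset.subset_union_left hy) _ ?_
      · have b (j) (hj : j ∈ T₁ ∪ TA) : j < n := by
          rcases Finset.mem_union.1 hj with h | h
          · have := hT₁ _ h
            omega
          · exact (hTA _ h).2
        have := b _ hk
        have := b _ hk'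
        omega
      · simpa using coordSub_mono Finset.subset_union_right ha
    rw [hg, bform_basisVec_right (by omega)] at h
    simp (disch := omega) only [planeFst, map_add, map_smul, coord_basisVec_self,
      coord_basisVec_of_ne, smul_eq_mul, Nat.sub_zero] at h
    exact one_ne_zero (by linear_combination h)
  exact (sub_eq_zero.1 ((mul_eq_zero.1 hst).resolve_left hp)).symm

/-- The parameter of the family of planes is an invariant of the triple when `β = n`. -/
theorem maxPlane_param_eq (hchar : (2 : F) ≠ 0) (hn : 3 ≤ n) {t s : F}
    {g : (Fin (2*n+1) → F) ≃ₗ[F] (Fin (2*n+1) → F)} (hg : IsOrthMap F (2*n+1) g)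
    {TA TB T₁ T₂ T₃ : Finset ℕ} (hTA : ∀ k ∈ TA, 3 ≤ k ∧ k < n)
    (hTB : ∀ k ∈ TB, (3 ≤ k ∧ k < n) ∨ k = 2*n-2 ∨ k = 2*n-1 ∨ k = 2*n)
    (hB₀ : 2*n-2 ∈ TB) (hB₁ : 2*n-1 ∈ TB) (hB₂ : 2*n ∈ TB)
    (hT₁ : ∀ k ∈ T₁, k = 0 ∨ (3 ≤ k ∧ k < n)) (h₁ : 0 ∈ T₁)
    (hT₂ : ∀ k ∈ T₂, k ≠ 2 ∧ k < n) (h₂₀ : 0 ∈ T₂) (h₂₁ : 1 ∈ T₂)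
    (hT₃ : ∀ k ∈ T₃, k < n) (h₃₁ : 1 ∈ T₃) (h₃₂ : 2 ∈ T₃)
    (hA : ∀ x, g x ∈ extSub (maxPlaneFst F n s) (maxPlaneSnd F n s) TA ↔
      x ∈ extSub (maxPlaneFst F n t) (maxPlaneSnd F n t) TA)
    (hB : ∀ x, g x ∈ coordSub F n TB ↔ x ∈ coordSub F n TB)
    (hC₁ : ∀ x, g x ∈ coordSub F n T₁ ↔ x ∈ coordSub F n T₁)
    (hC₂ : ∀ x, g x ∈ coordSub F n T₂ ↔ x ∈ coordSub F n T₂)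
    (hC₃ : ∀ x, g x ∈ coordSub F n T₃ ↔ x ∈ coordSub F n T₃) : t = s := by
  have zA {x} (hx : x ∈ coordSub F n TA) (k) (hk : ¬ (3 ≤ k ∧ k < n)) : coord F n k x = 0 :=
    hx k fun h => hk (hTA k h)
  have zB {x} (hx : x ∈ coordSub F n TB) (k)
      (hk : ¬ ((3 ≤ k ∧ k < n) ∨ k = 2*n-2 ∨ k = 2*n-1 ∨ k = 2*n)) :
      coord F n k x = 0 := hx k fun h => hk (hTB k h)
  have z₁ {x} (hx : x ∈ coordSub F n T₁) (k) (hk : ¬ (k = 0 ∨ (3 ≤ k ∧ k < n))) :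
      coord F n k x = 0 := hx k fun h => hk (hT₁ k h)
  have z₂ {x} (hx : x ∈ coordSub F n T₂) (k) (hk : ¬ (k ≠ 2 ∧ k < n)) :
      coord F n k x = 0 := hx k fun h => hk (hT₂ k h)
  have z₃ {x} (hx : x ∈ coordSub F n T₃) (k) (hk : ¬ (k < n)) :
      coord F n k x = 0 := hx k fun h => hk (hT₃ k h)
  have sub₀ : 2*n-n = n := by omega
  have sub₁ : 2*n-(2*n-2) = 2 := by omega
  have sub₂ : 2*n-(2*n-1) = 1 := by omega
  obtain ⟨p, q, a, ha, hu⟩ := mem_extSub.1 ((hA _).2 (left_mem_extSub _ _ _))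
  obtain ⟨p', q', a', ha', hw⟩ := mem_extSub.1 ((hA _).2 (right_mem_extSub _ _ _))
  -- the middle coordinate of `g u` vanishes, since `u ⊥ B^⊥ ∩ C₃^⊥`
  have hq : q = 0 := by
    have h : bform F (2*n+1) (g (maxPlaneFst F n t)) (basisVec F n n) = 0 := by
      rw [bform_map_eq hg, bform_comm]
      have hyB (b) (hb : b ∈ coordSub F n TB) :
          bform F (2*n+1) b (g.symm (basisVec F n n)) = 0 := by
        rw [← bform_map_eq hg, bform_basisVec_right (by omega)]
        exact zB ((hB _).2 hb) _ (by omega)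
      have hy₃ (b) (hb : b ∈ coordSub F n T₃) :
          bform F (2*n+1) b (g.symm (basisVec F n n)) = 0 := by
        rw [← bform_map_eq hg, bform_basisVec_right (by omega)]
        exact z₃ ((hC₃ _).2 hb) _ (by omega)
      have e₀ := hyB _ (basisVec_mem hB₂)
      have e₁ := hy₃ _ (basisVec_mem h₃₁)
      have e₂ := hy₃ _ (basisVec_mem h₃₂)
      rw [bform_comm, bform_basisVec_right (by omega)] at e₀ e₁ e₂
      rw [Nat.sub_self] at e₀
      rw [bform_maxPlaneFst hn, e₀, e₁, e₂]
      ring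
    rw [hu, bform_basisVec_right (by omega), sub₀] at h
    simp (disch := omega) only [maxPlaneFst, maxPlaneSnd, map_add, map_smul, coord_basisVec_self,
      coord_basisVec_of_ne, smul_eq_mul, zA ha] at h
    apply mul_left_cancel₀ hchar
    linear_combination h
  have hp' : p' = 0 := by
    have h : bform F (2*n+1) (g (maxPlaneSnd F n t)) (basisVec F n 0) = 0 := by
      rw [bform_map_eq hg, bform_comm]
      have hy := (hC₁ (g.symm (basisVec F n 0))).1
        (by rw [g.apply_symm_apply]; exact basisVec_mem h₁)
      simp (disch := omega) only [bform_maxPlaneSnd hn, z₁ hy]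
      ring
    rw [hw, bform_basisVec_right (by omega)] at h
    simp (disch := omega) only [maxPlaneFst, maxPlaneSnd, map_add, map_smul, coord_basisVec_self,
      coord_basisVec_of_ne, smul_eq_mul, zA ha', Nat.sub_zero] at h
    linear_combination h
  subst hq hp'
  have hpq : p = q' := by
    have h : bform F (2*n+1) (g (maxPlaneFst F n t + maxPlaneSnd F n t))
        (basisVec F n (2*n-2)) = 0 := by
      rw [bform_map_eq hg, bform_comm]
      have hyB := (hB (g.symm (basisVec F n (2*n-2)))).1
        (by rw [g.apply_symm_apply]; exact basisVec_mem hB₀)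
      have hy (x) (hx : x ∈ coordSub F n T₂) :
          bform F (2*n+1) x (g.symm (basisVec F n (2*n-2))) = 0 := by
        rw [← bform_map_eq hg, bform_basisVec_right (by omega), sub₁]
        exact z₂ ((hC₂ _).2 hx) _ (by omega)
      have e₀ := hy _ (basisVec_mem h₂₀)
      have e₁ := hy _ (basisVec_mem h₂₁)
      rw [bform_comm, bform_basisVec_right (by omega)] at e₀ e₁
      rw [Nat.sub_zero] at e₀
      simp (disch := omega) only [bform_add_right, bform_maxPlaneFst hn, bform_maxPlaneSnd hn,
        zB hyB, e₀, e₁]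
      ring
    rw [map_add, hu, hw, bform_basisVec_right (by omega), sub₁] at h
    simp (disch := omega) only [maxPlaneFst, maxPlaneSnd, map_add, map_smul, coord_basisVec_self,
      coord_basisVec_of_ne, smul_eq_mul, zA ha', zA ha] at h
    linear_combination h
  subst hpq
  have hst : p * (s - t) = 0 := by
    have h : bform F (2*n+1) (g ((2 : F) • maxPlaneFst F n t + t • maxPlaneSnd F n t))
        (basisVec F n (2*n-1)) = 0 := by
      rw [bform_map_eq hg, bform_comm]
      have hyB := (hB (g.symm (basisVec F n (2*n-1)))).1
        (by rw [g.apply_symm_apply]; exact basisVec_mem hB₁)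
      have e₀ : bform F (2*n+1) (g.symm (basisVec F n (2*n-1))) (basisVec F n 0) = 0 := by
        rw [bform_symm_eq hg, bform_comm, bform_basisVec_right (by omega), sub₂]
        exact z₁ ((hC₁ _).2 (basisVec_mem h₁)) _ (by omega)
      have e₂ : bform F (2*n+1) (g.symm (basisVec F n (2*n-1))) (basisVec F n 2) = 0 := by
        rw [bform_symm_eq hg, bform_comm, bform_basisVec_right (by omega), sub₂]
        have hx₃ := (hC₃ (basisVec F n 2)).2 (basisVec_mem h₃₂)
        have hxA (v) (hv : v ∈ extSub (maxPlaneFst F n s) (maxPlaneSnd F n s) TA) :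
            bform F (2*n+1) (g (basisVec F n 2)) v = 0 := by
          rw [bform_map_eq hg, bform_comm]
          obtain ⟨x, y, z, hz, hxyz⟩ := mem_extSub.1
            ((hA (g.symm v)).1 (by rwa [g.apply_symm_apply]))
          rw [hxyz, bform_basisVec_right (by omega)]
          simp (disch := omega) only [maxPlaneFst, maxPlaneSnd, map_add, map_smul,
            coord_basisVec_of_ne, smul_eq_mul, zA hz]
          ring
        have hxw := hxA _ (right_mem_extSub _ _ _)
        simp (disch := omega) only [bform_maxPlaneSnd hn, z₃ hx₃] at hxw
        linear_combination hxw
      rw [bform_basisVec_right (by omega)] at e₀ e₂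
      rw [Nat.sub_zero] at e₀
      simp (disch := omega) only [bform_add_right, bform_smul_right, bform_maxPlaneFst hn,
        bform_maxPlaneSnd hn, zB hyB, e₀, e₂]
      ring
    rw [map_add, map_smul, map_smul, hu, hw, bform_basisVec_right (by omega), sub₂] at h
    simp (disch := omega) only [maxPlaneFst, maxPlaneSnd, map_add, map_smul, coord_basisVec_self,
      coord_basisVec_of_ne, smul_eq_mul, zA ha', zA ha] at h
    apply mul_left_cancel₀ hchar
    linear_combination h
  have hp : p ≠ 0 := by
    rintro rfl
    have h : bform F (2*n+1) (g (maxPlaneFst F n t)) (g (basisVec F n 0)) = 0 := by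
      rw [hu, bform_comm]
      have hy := (hC₁ (basisVec F n 0)).2 (basisVec_mem h₁)
      refine isIsotropic_coordSub (T := T₁ ∪ TA) (fun k hk _ hk' => ?_) _
        (coordSub_mono Finset.subset_union_left hy) _ ?_
      · have b (j) (hj : j ∈ T₁ ∪ TA) : j < n := by
          rcases Finset.mem_union.1 hj with h | h
          · have := hT₁ _ h
            omega
          · exact (hTA _ h).2
        have := b _ hk
        have := b _ hk'
        omega
      · simpa using coordSub_mono Finset.subset_union_right ha
    rw [hg, bform_basisVec_right (by omega)] at h
    simp (disch := omega) only [maxPlaneFst, map_add, map_smul, coord_basisVec_self,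
      coord_basisVec_of_ne, smul_eq_mul, Nat.sub_zero] at h
    exact one_ne_zero (by linear_combination h)
  exact (sub_eq_zero.1 ((mul_eq_zero.1 hst).resolve_left hp)).symm

/-- Index sets of a coordinate flag; the first three steps pick up `0`, `1`, `2` in turn. -/
def flagIndex {r : ℕ} (c : Fin r → ℕ) (i : Fin r) : Finset ℕ :=
  Finset.range (min (i+1) 3) ∪ Finset.Ico 3 (3 + ∑ j ∈ Finset.Iic i, (c j - 1) + (i + 1 - 3))

theorem mem_flagIndex {r : ℕ} {c : Fin r → ℕ} {i : Fin r} {k : ℕ} : k ∈ flagIndex c i ↔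
    (k < i + 1 ∧ k < 3) ∨
      (3 ≤ k ∧ k < 3 + ∑ j ∈ Finset.Iic i, (c j - 1) + (i + 1 - 3)) := by
  simp [flagIndex]

theorem lt_of_mem_flagIndex {r : ℕ} {c : Fin r → ℕ} (hc : ∀ i, 0 < c i) (hr : 3 ≤ r)
    (hsum : ∑ i, c i ≤ n) {i : Fin r} {k : ℕ} (hk : k ∈ flagIndex c i) : k < n := by
  have h1 : ∑ j ∈ Finset.Iic i, (c j - 1) ≤ ∑ j, (c j - 1) :=
    Finset.sum_le_sum_of_subset (Finset.subset_univ _)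
  have h2 : ∑ j, (c j - 1) + r = ∑ j, c j := by
    have : ∑ j, (c j - 1) + r = ∑ j, (c j - 1 + 1) := by simp [Finset.sum_add_distrib]
    rw [this]
    exact Finset.sum_congr rfl fun j _ => Nat.sub_add_cancel (hc j)
  have := i.isLt
  rw [mem_flagIndex] at hk
  omega

theorem card_flagIndex {r : ℕ} {c : Fin r → ℕ} (hc : ∀ i, 0 < c i) (i : Fin r) :
    (flagIndex c i).card = ∑ j ∈ Finset.Iic i, c j := by
  have h : ∑ j ∈ Finset.Iic i, (c j - 1) + (i + 1) = ∑ j ∈ Finset.Iic i, c j := by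
    have : ∑ _j ∈ Finset.Iic i, 1 = (i : ℕ) + 1 := by simp
    rw [← this, ← Finset.sum_add_distrib]
    exact Finset.sum_congr rfl fun j _ => Nat.sub_add_cancel (hc j)
  rw [flagIndex, Finset.card_union_of_disjoint, Finset.card_range, Nat.card_Ico]
  · omega
  · rw [Finset.disjoint_left]
    intro k hk hk'
    simp at hk hk'
    omega

theorem flagIndex_mono {r : ℕ} (c : Fin r → ℕ) : Monotone (flagIndex c) := by
  intro i j hij k hk
  have h1 : ∑ j ∈ Finset.Iic i, (c j - 1) ≤ ∑ j ∈ Finset.Iic j, (c j - 1) :=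
    Finset.sum_le_sum_of_subset (Finset.Iic_subset_Iic.2 hij)
  have h2 : (i : ℕ) ≤ j := hij
  rw [mem_flagIndex] at hk ⊢
  omega

theorem isFlag_flagIndex {r : ℕ} {c : Fin r → ℕ} (hc : ∀ i, 0 < c i) (hr : 3 ≤ r)
    (hsum : ∑ i, c i ≤ n) : IsFlag F n r c fun i => coordSub F n (flagIndex c i) := by
  have h {i k} (hk : k ∈ flagIndex c i) : k < n := lt_of_mem_flagIndex hc hr hsum hk
  refine ⟨fun i j hij => coordSub_mono (flagIndex_mono c hij), fun i => ?_, fun i => ?_⟩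
  · rw [finrank_coordSub (fun k hk => by have := h hk; omega), card_flagIndex hc]
  · refine isIsotropic_coordSub fun k hk _ hk' => ?_
    have := h hk
    have := h hk'
    omega

theorem isFlag_const {d : ℕ} {V : Submodule F (Fin (2*n+1) → F)} (hd : finrank F V = d)
    (hV : IsIsotropic F (2*n+1) V) : IsFlag F n 1 ![d] fun _ => V := by
  refine ⟨monotone_const, fun i => ?_, fun _ => hV⟩
  rw [hd, Subsingleton.elim i 0]
  simp

theorem mem_iff_of_map_eq {g : (Fin (2*n+1) → F) ≃ₗ[F] (Fin (2*n+1) → F)}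
    {S T : Submodule F (Fin (2*n+1) → F)} (h : S.map g.toLinearMap = T)
    (x : Fin (2*n+1) → F) : g x ∈ T ↔ x ∈ S := by
  subst h
  exact Function.Injective.mem_set_image g.injective

/-- A one-parameter family of triples which has only finitely many orbits contains two
equivalent members. -/
theorem exists_ne_tripleRel [Infinite F] {p q r : ℕ} {a : Fin p → ℕ} {b : Fin q → ℕ}
    {c : Fin r → ℕ} (hfin : Finite (Quot (TripleRel F n p q r a b c)))
    (X : F → FlagVar F n p a × FlagVar F n q b × FlagVar F n r c) :
    ∃ t s, t ≠ s ∧ TripleRel F n p q r a b c (X t) (X s) := by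
  obtain ⟨t, s, hts, h⟩ := Finite.exists_ne_map_eq_of_infinite
    fun t => Quot.mk (TripleRel F n p q r a b c) (X t)
  exact ⟨t, s, hts, (tripleRel_equivalence p q r a b c).eqvGen_iff.1 (Quot.eqvGen_exact h)⟩

end OrthTriple

open OrthTriple

/-- Proposition 2.19: with `a = (α)`, `b = (β)`, `c = (γ_1,…,γ_r)`,
`r ≥ 3` and `α ≤ β`, if `M_a × M_b × M_c` has finitely many `O_{2n+1}(F)`-orbits,
then `α = 1` or `α = β = n`. -/
theorem statement13 (F : Type*) [Field F] [Infinite F] (hchar : (2 : F) ≠ 0)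
    (n : ℕ) (hn : 1 ≤ n) (α β : ℕ) (r : ℕ) (hr : 3 ≤ r) (c : Fin r → ℕ)
    (hα : 0 < α) (hβ : 0 < β) (hcpos : ∀ i, 0 < c i)
    (hαn : α ≤ n) (hβn : β ≤ n) (hcsum : (∑ i, c i) ≤ n)
    (hab : α ≤ β)
    (hfin : Finite (Quot (TripleRel F n 1 1 r ![α] ![β] c))) :
    α = 1 ∨ (α = n ∧ β = n) := by
  by_contra hcon
  have hn3 : 3 ≤ n := by
    have : ∑ _i : Fin r, 1 ≤ ∑ i, c i := Finset.sum_le_sum fun i _ => hcpos i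
    simp at this
    omega
  have hα2 : 2 ≤ α := by omega
  have hαn' : α < n := by omega
  have hTA : ∀ k ∈ Finset.Ico 3 (α+1), 3 ≤ k ∧ k < n := fun k hk => by
    rw [Finset.mem_Ico] at hk
    omega
  have hTC {i : Fin r} {k : ℕ} (hk : k ∈ flagIndex c i) : k < n :=
    lt_of_mem_flagIndex hcpos hr hcsum hk
  have hT₁ : ∀ k ∈ flagIndex c ⟨0, by omega⟩, k = 0 ∨ (3 ≤ k ∧ k < n) := fun k hk => by
    have := hTC hk
    rw [mem_flagIndex] at hk
    simp only at hk
    omega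
  have hC := isFlag_flagIndex (F := F) hcpos hr hcsum
  have hcard : (Finset.Ico 3 (α+1)).card + 2 = α := by
    rw [Nat.card_Ico]
    omega
  rcases hβn.lt_or_eq with hβ' | hβ'
  · have hB : IsFlag F n 1 ![β]
        fun _ => coordSub F n (Finset.Ico 3 (β+1) ∪ {2*n-1, 2*n}) := by
      refine isFlag_const ?_ (isIsotropic_coordSub fun k hk _ hk' => ?_)
      · rw [finrank_coordSub, Finset.card_union_of_disjoint, Nat.card_Ico,
          Finset.card_pair (by omega)]
        · omega
        · rw [Finset.disjoint_left]
          intro k hk hk'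
          simp at hk hk'
          omega
        · intro k hk
          simp at hk
          omega
      · simp at hk hk'
        omega
    obtain ⟨t, s, hts, g, hg, h1, h2, h3⟩ := exists_ne_tripleRel hfin fun t =>
      (⟨_, isFlag_const ((finrank_plane hn3 t hTA).trans hcard) (isIsotropic_plane hn3 t hTA)⟩,
        ⟨_, hB⟩, ⟨_, hC⟩)
    refine hts (plane_param_eq hchar hn3 hg hTA (fun k hk => ?_) ?_ ?_ hT₁ ?_
      (fun k hk => hTC hk) ?_ ?_ (mem_iff_of_map_eq (h1 0)) (mem_iff_of_map_eq (h2 0))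
      (mem_iff_of_map_eq (h3 ⟨0, by omega⟩)) (mem_iff_of_map_eq (h3 ⟨2, by omega⟩)))
    · simp at hk
      omega
    all_goals simp [mem_flagIndex]
  · have hB : IsFlag F n 1 ![β]
        fun _ => coordSub F n (Finset.Ico 3 n ∪ {2*n-2, 2*n-1, 2*n}) := by
      refine isFlag_const ?_ (isIsotropic_coordSub fun k hk _ hk' => ?_)
      · rw [finrank_coordSub, Finset.card_union_of_disjoint, Nat.card_Ico,
          Finset.card_eq_three.2 ⟨_, _, _, (by omega), (by omega), (by omega), rfl⟩]
        · omega
        · rw [Finset.disjoint_left]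
          intro k hk hk'
          simp at hk hk'
          omega
        · intro k hk
          simp at hk
          omega
      · simp at hk hk'
        omega
    obtain ⟨t, s, hts, g, hg, h1, h2, h3⟩ := exists_ne_tripleRel hfin fun t =>
      (⟨_, isFlag_const ((finrank_maxPlane hn3 t hTA).trans hcard)
        (isIsotropic_maxPlane hn3 t hTA)⟩, ⟨_, hB⟩, ⟨_, hC⟩)
    refine hts (maxPlane_param_eq hchar hn3 hg hTA (fun k hk => ?_) ?_ ?_ ?_ hT₁ ?_
      (T₂ := flagIndex c ⟨1, by omega⟩) (fun k hk => ?_) ?_ ?_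
      (fun k hk => hTC hk) ?_ ?_ (mem_iff_of_map_eq (h1 0)) (mem_iff_of_map_eq (h2 0))
      (mem_iff_of_map_eq (h3 ⟨0, by omega⟩)) (mem_iff_of_map_eq (h3 ⟨1, by omega⟩))
      (mem_iff_of_map_eq (h3 ⟨2, by omega⟩)))
    · simp at hk
      omega
    case refine_6 =>
      have := hTC hk
      rw [mem_flagIndex] at hk
      simp only at hk
      omega
    all_goals simp [mem_flagIndex]
end
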